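/- Let p be a prime and F a field of characteristic p that is p-cyclic reducible. Let A be a central simple F-algebra with exp A = p. Let K/F be a finite purely inseparable field extension with K^p ⊆ F such that ind A_K = p^n for a positive integer n. Then there exists a purely inseparable field extension K'/K with K'^p ⊆ F, [K':K] ≤ p^{(p−1)·p^{n−1}}, and ind A_{K'} ≤ p^{n−1}. -/

import Mathlib

open scoped TensorProduct

/-- A finite-dimensional central simple algebra over a field `F`. -/
def IsCSA (F A : Type) [Field F] [Ring A] [Algebra F A] : Prop :=
  Algebra.IsCentral F A ∧ IsSimpleRing A ∧ FiniteDimensional F A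

/-- An `F`-algebra is split if it is isomorphic to a matrix algebra over `F`. -/
def IsSplitAlg (F A : Type) [Field F] [Ring A] [Algebra F A] : Prop :=
  ∃ n : ℕ, 0 < n ∧ Nonempty (A ≃ₐ[F] Matrix (Fin n) (Fin n) F)

/-- Brauer equivalence of two algebras over a field `F`. -/
def IsBrauerEquiv (F A B : Type) [Field F] [Ring A] [Algebra F A] [Ring B] [Algebra F B] :
    Prop :=
  ∃ n m : ℕ, 0 < n ∧ 0 < m ∧
    Nonempty ((Matrix (Fin n) (Fin n) A) ≃ₐ[F] (Matrix (Fin m) (Fin m) B))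

/-- `A` has exponent `e`: `e` is the least positive integer such that the `e`-fold tensor
power of `A` over `F` is split. -/
def HasExponent (F A : Type) [Field F] [Ring A] [Algebra F A] (e : ℕ) : Prop :=
  0 < e ∧ IsSplitAlg F (⨂[F] _ : Fin e, A) ∧
    ∀ k : ℕ, 0 < k → IsSplitAlg F (⨂[F] _ : Fin k, A) → e ≤ k

/-- `A` has (Schur) index `d`: `A` is isomorphic to a matrix algebra over a division
algebra of dimension `d ^ 2` over `F`. -/
def HasIndex (F A : Type) [Field F] [Ring A] [Algebra F A] (d : ℕ) : Prop :=
  ∃ (D : Type) (_ : DivisionRing D) (_ : Algebra F D) (m : ℕ), 0 < m ∧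
    Nonempty (A ≃ₐ[F] Matrix (Fin m) (Fin m) D) ∧ Module.finrank F D = d ^ 2

/-- The (Schur) index of `A` is at most `d`. -/
def IndexLE (F A : Type) [Field F] [Ring A] [Algebra F A] (d : ℕ) : Prop :=
  ∃ e : ℕ, e ≤ d ∧ HasIndex F A e

/-- `A` is the cyclic (symbol) algebra `[a, b)_{p,F}` of degree `p` in characteristic `p`:
it has dimension `p ^ 2` over `F` and is generated by elements `i`, `j` subject to
`i ^ p - i = a`, `j ^ p = b`, `j * i = (i - 1) * j`. -/
def IsCyclicAlgWith (p : ℕ) (F A : Type) [Field F] [Ring A] [Algebra F A] (a b : F) : Prop :=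
  b ≠ 0 ∧ Module.finrank F A = p ^ 2 ∧
    ∃ i j : A, i ^ p - i = algebraMap F A a ∧ j ^ p = algebraMap F A b ∧
      j * i = (i - 1) * j ∧ Algebra.adjoin F {i, j} = ⊤

/-- `A` is a cyclic algebra of degree `p`, i.e. of the form `[a, b)_{p,F}`. -/
def IsCyclicPAlg (p : ℕ) (F A : Type) [Field F] [Ring A] [Algebra F A] : Prop :=
  ∃ a b : F, IsCyclicAlgWith p F A a b

/-- The `p`-symbol length of `A` is at most `m`: `A` is Brauer equivalent to a tensor
product of at most `m` cyclic `F`-algebras of degree `p`. -/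
def SymbolLengthLE (p : ℕ) (F A : Type) [Field F] [Ring A] [Algebra F A] (m : ℕ) : Prop :=
  ∃ k : ℕ, k ≤ m ∧ ∃ (D : Fin k → Type) (_ : ∀ i, Ring (D i)) (_ : ∀ i, Algebra F (D i)),
    (∀ i, IsCyclicPAlg p F (D i)) ∧ IsBrauerEquiv F A (⨂[F] i, D i)

/-- `M` is a compositum `LK` of `L` and `K` over `F`: it is generated as an `F`-algebra by
the images of `L` and `K`. -/
def IsCompositum (F L K M : Type) [Field F] [Field L] [Field K] [Field M]
    [Algebra F L] [Algebra F K] [Algebra F M] [Algebra L M] [Algebra K M]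
    [IsScalarTower F L M] [IsScalarTower F K M] : Prop :=
  (IsScalarTower.toAlgHom F L M).range ⊔ (IsScalarTower.toAlgHom F K M).range = ⊤

/-- A cyclic algebra of degree `m` over `F`: a central simple `F`-algebra of degree `m`
containing a cyclic field extension of `F` of degree `m` (as a maximal subfield). -/
def IsCyclicAlgebra (F A : Type) [Field F] [Ring A] [Algebra F A] (m : ℕ) : Prop :=
  IsCSA F A ∧ Module.finrank F A = m ^ 2 ∧
  ∃ (L : Type) (_ : Field L) (_ : Algebra F L), IsGalois F L ∧ IsCyclic (L ≃ₐ[F] L) ∧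
    Module.finrank F L = m ∧ Nonempty (L →ₐ[F] A)

/-- `L/F` is a `p`-extension: there is a tower of intermediate fields from `F` to `L`
each step of which is a cyclic extension of degree `p`. -/
def IsPExtension (p : ℕ) (F L : Type) [Field F] [Field L] [Algebra F L] : Prop :=
  ∃ (n : ℕ) (T : Fin (n + 1) → IntermediateField F L),
    T 0 = ⊥ ∧ T (Fin.last n) = ⊤ ∧
    ∀ i : Fin n, ∃ h : T i.castSucc ≤ T i.succ,
      IsGalois (T i.castSucc) (IntermediateField.extendScalars h) ∧
      IsCyclic ((IntermediateField.extendScalars h) ≃ₐ[T i.castSucc]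
        (IntermediateField.extendScalars h)) ∧
      Module.finrank (T i.castSucc) (IntermediateField.extendScalars h) = p

/-- `F` is `p`-cyclic reducible: for every central simple `F`-algebra `A` of exponent `p`
and every purely inseparable extension `K/F` with `K ^ p ⊆ F`, either `A_K` is split, or
there is a separable extension `L/F` of degree `ind (A_K) / p` such that `A_{LK}` is
Brauer equivalent to a cyclic `LK`-algebra of degree `p`. -/
def IsPCyclicReducible (p : ℕ) (F : Type) [Field F] : Prop :=
  ∀ (A : Type) [Ring A] [Algebra F A], IsCSA F A → HasExponent F A p →
  ∀ (K : Type) [Field K] [Algebra F K], IsPurelyInseparable F K →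
    (∀ z : K, z ^ p ∈ (algebraMap F K).range) →
    IsSplitAlg K (K ⊗[F] A) ∨
    ∃ d : ℕ, HasIndex K (K ⊗[F] A) (p * d) ∧
      ∃ (L : Type) (_ : Field L) (_ : Algebra F L), Algebra.IsSeparable F L ∧
        Module.finrank F L = d ∧
        ∃ (M : Type) (_ : Field M) (_ : Algebra F M) (_ : Algebra L M) (_ : Algebra K M)
          (_ : IsScalarTower F L M) (_ : IsScalarTower F K M),
          IsCompositum F L K M ∧
          ∃ (C : Type) (_ : Ring C) (_ : Algebra M C),
            IsCyclicPAlg p M C ∧ IsBrauerEquiv M (M ⊗[F] A) C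

/-- `F` is `p`-reducible: for every central simple `F`-algebra `A` of exponent `p`
and every purely inseparable extension `K/F` with `K ^ p ⊆ F`, either `A_K` is split, or
there is a separable extension `L/F` of degree `ind (A_K) / p` with `ind A_{LK} = p`. -/
def IsPReducible (p : ℕ) (F : Type) [Field F] : Prop :=
  ∀ (A : Type) [Ring A] [Algebra F A], IsCSA F A → HasExponent F A p →
  ∀ (K : Type) [Field K] [Algebra F K], IsPurelyInseparable F K →
    (∀ z : K, z ^ p ∈ (algebraMap F K).range) →
    IsSplitAlg K (K ⊗[F] A) ∨
    ∃ d : ℕ, HasIndex K (K ⊗[F] A) (p * d) ∧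
      ∃ (L : Type) (_ : Field L) (_ : Algebra F L), Algebra.IsSeparable F L ∧
        Module.finrank F L = d ∧
        ∃ (M : Type) (_ : Field M) (_ : Algebra F M) (_ : Algebra L M) (_ : Algebra K M)
          (_ : IsScalarTower F L M) (_ : IsScalarTower F K M),
          IsCompositum F L K M ∧ HasIndex M (M ⊗[F] A) p

theorem isSimpleRing_baseChange (F E A : Type*) [Field F] [Field E] [Algebra F E] [Ring A]
    [Algebra F A] [Algebra.IsCentral F A] [IsSimpleRing A] : IsSimpleRing (E ⊗[F] A) := by
  classical
  let b := Module.Basis.ofVectorSpace F E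
  let c := TensorProduct.equivFinsuppOfBasisLeft (N := A) b
  have hcl : ∀ (a : A) (x : E ⊗[F] A) i, c ((1 ⊗ₜ a) * x) i = a * c x i := by
    intro a x i
    induction x with
    | zero => simp
    | tmul u v => simp [c]
    | add u v hu hv => simp [mul_add, hu, hv]
  have hcr : ∀ (a : A) (x : E ⊗[F] A) i, c (x * (1 ⊗ₜ a)) i = c x i * a := by
    intro a x i
    induction x with
    | zero => simp
    | tmul u v => simp [c]
    | add u v hu hv => simp [add_mul, hu, hv]
  refine IsSimpleRing.of_eq_bot_or_eq_top fun I => or_iff_not_imp_left.2 fun hI => ?_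
  obtain ⟨x₀, hx₀, hx₀'⟩ : ∃ x ∈ I, x ≠ 0 := by
    by_contra! h
    exact hI (le_bot_iff.1 fun x hx => by simpa using h x hx)
  have hex : ∃ k, ∃ x ∈ I, x ≠ 0 ∧ (c x).support.card = k := ⟨_, x₀, hx₀, hx₀', rfl⟩
  obtain ⟨x, hxI, hx0, hxk⟩ := Nat.find_spec hex
  have hmin : ∀ y ∈ I, (c y).support.card < (c x).support.card → y = 0 := by
    intro y hy hlt
    by_contra hne
    exact Nat.find_min hex (hxk ▸ hlt) ⟨y, hy, hne, rfl⟩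
  obtain ⟨i₀, hi₀⟩ : ∃ i, c x i ≠ 0 := by
    by_contra! h
    exact hx0 (c.map_eq_zero_iff.1 (Finsupp.ext h))
  let J : TwoSidedIdeal A := TwoSidedIdeal.mk'
    {a | ∃ y ∈ I, (∀ i, c x i = 0 → c y i = 0) ∧ c y i₀ = a}
    ⟨0, I.zero_mem, by simp, by simp⟩
    (by
      rintro _ _ ⟨y, hy, hys, rfl⟩ ⟨z, hz, hzs, rfl⟩
      exact ⟨y + z, I.add_mem hy hz, fun i hi => by simp [hys i hi, hzs i hi], by simp⟩)
    (by
      rintro _ ⟨y, hy, hys, rfl⟩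
      exact ⟨-y, I.neg_mem hy, fun i hi => by simp [hys i hi], by simp⟩)
    (by
      rintro a _ ⟨y, hy, hys, rfl⟩
      exact ⟨(1 ⊗ₜ a) * y, I.mul_mem_left _ _ hy, fun i hi => by simp [hcl, hys i hi], hcl _ _ _⟩)
    (by
      rintro _ a ⟨y, hy, hys, rfl⟩
      exact ⟨y * (1 ⊗ₜ a), I.mul_mem_right _ _ hy, fun i hi => by simp [hcr, hys i hi], hcr _ _ _⟩)
  have h1 : (1 : A) ∈ J := IsSimpleRing.one_mem_of_ne_zero_mem (x := c x i₀) J hi₀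
    ((TwoSidedIdeal.mem_mk' ..).2 ⟨x, hxI, fun _ h => h, rfl⟩)
  obtain ⟨y, hyI, hys, hy1⟩ := (TwoSidedIdeal.mem_mk' ..).1 h1
  have hcomm : ∀ a i, c y i * a = a * c y i := by
    intro a i
    have hz : (1 ⊗ₜ a) * y - y * (1 ⊗ₜ a) = 0 := by
      refine hmin _ (I.sub_mem (I.mul_mem_left _ _ hyI) (I.mul_mem_right _ _ hyI)) ?_
      refine Finset.card_lt_card (Finset.ssubset_iff_of_subset ?_ |>.2 ⟨i₀, ?_, ?_⟩)
      · intro i hi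
        rw [Finsupp.mem_support_iff] at hi ⊢
        contrapose! hi
        simp [hcl, hcr, hys i hi]
      · simpa using hi₀
      · simp [hcl, hcr, hy1]
    have := hcl a y i
    rw [sub_eq_zero.1 hz, hcr] at this
    exact this
  have hcen : ∀ i, ∃ f : F, algebraMap F A f = c y i := fun i => by
    have : c y i ∈ Subalgebra.center F A := Subalgebra.mem_center_iff.2 fun a => (hcomm a i).symm
    exact Algebra.mem_bot.1 (Algebra.IsCentral.out this)
  choose f hf using hcen
  have hy : y = ((c y).sum fun i _ => f i • b i) ⊗ₜ 1 := by
    conv_lhs => rw [← c.symm_apply_apply y, TensorProduct.equivFinsuppOfBasisLeft_symm_apply]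
    rw [Finsupp.sum, Finsupp.sum, TensorProduct.sum_tmul]
    refine Finset.sum_congr rfl fun i _ => ?_
    rw [← hf, Algebra.algebraMap_eq_smul_one, TensorProduct.tmul_smul, TensorProduct.smul_tmul']
  set e := (c y).sum fun i _ => f i • b i
  have he : e ≠ 0 := by
    rintro h
    rw [h, TensorProduct.zero_tmul] at hy
    rw [hy] at hy1
    simp at hy1
  have : (1 : E ⊗[F] A) ∈ I := by
    have := I.mul_mem_left (e⁻¹ ⊗ₜ 1) _ hyI
    rw [hy] at this
    simpa [inv_mul_cancel₀ he, ← Algebra.TensorProduct.one_def] using this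
  exact I.one_mem_iff.1 this

theorem le_finrank_of_algHom {F D N : Type*} [Field F] [DivisionRing D] [Algebra F D]
    [AddCommGroup N] [Module F N] [FiniteDimensional F N] [Nontrivial N] {r : ℕ}
    (f : Matrix (Fin r) (Fin r) D →ₐ[F] Module.End F N) :
    r * Module.finrank F D ≤ Module.finrank F N := by
  classical
  obtain ⟨v, hv⟩ := exists_ne (0 : N)
  obtain ⟨i, hi⟩ : ∃ i, f (Matrix.single i i 1) v ≠ 0 := by
    by_contra! h
    apply hv
    have h1 : (∑ i, Matrix.single i i (1 : D)) = (1 : Matrix (Fin r) (Fin r) D) :=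
      Matrix.sum_single_one
    calc v = f 1 v := by simp
      _ = 0 := by rw [← h1, map_sum, LinearMap.sum_apply]; simp [h]
  let g : (Fin r → D) →ₗ[F] N :=
    { toFun := fun d => ∑ k, f (Matrix.single k i (d k)) v
      map_add' := fun x y => by
        simp [Matrix.single_add, Finset.sum_add_distrib]
      map_smul' := fun c x => by
        simp [← Matrix.smul_single, Finset.smul_sum] }
  have hg : Function.Injective g := by
    rw [injective_iff_map_eq_zero]
    intro d hd
    funext k
    by_contra hk
    apply hi
    have : f (Matrix.single i k (d k)⁻¹) (g d) = f (Matrix.single i i 1) v := by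
      simp only [g, LinearMap.coe_mk, AddHom.coe_mk, map_sum, ← Module.End.mul_apply, ← map_mul]
      rw [Finset.sum_eq_single k]
      · simp [inv_mul_cancel₀ hk]
      · intro l _ hl
        rw [Matrix.single_mul_single_of_ne _ _ _ _ (Ne.symm hl)]
        simp
      · simp
    rw [← this, hd, map_zero]
  have h : Module.Finite F (Fin r → D) := Module.Finite.of_injective g hg
  rcases Nat.eq_zero_or_pos r with rfl | hr
  · simp
  have : Module.Finite F D := Module.Finite.of_surjective
    (LinearMap.proj (R := F) (φ := fun _ : Fin r => D) ⟨0, hr⟩) (LinearMap.proj_surjective _)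
  simpa [Module.finrank_pi_fintype] using LinearMap.finrank_le_finrank_of_injective hg

/-- The action of matrices over `D` on column vectors, as an algebra homomorphism. -/
def matrixColumnAction (F D : Type*) [CommSemiring F] [Ring D] [Algebra F D] (r : ℕ) :
    Matrix (Fin r) (Fin r) D →ₐ[F] Module.End F (Fin r → D) where
  toFun M :=
    { toFun := M.mulVec
      map_add' := M.mulVec_add
      map_smul' := fun c v => M.mulVec_smul c v }
  map_one' := LinearMap.ext fun v => by simp
  map_mul' M N := LinearMap.ext fun v => by simp
  map_zero' := LinearMap.ext fun v => by simp
  map_add' M N := LinearMap.ext fun v => by simp [Matrix.add_mulVec]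
  commutes' c := LinearMap.ext fun v => by
    simp [Algebra.algebraMap_eq_smul_one, Matrix.smul_mulVec]

theorem finrank_eq_of_matrix_algEquiv {F D D' : Type*} [Field F] [DivisionRing D] [Algebra F D]
    [DivisionRing D'] [Algebra F D'] [FiniteDimensional F D] [FiniteDimensional F D'] {m m' : ℕ}
    (hm : 0 < m) (hm' : 0 < m')
    (e : Matrix (Fin m) (Fin m) D ≃ₐ[F] Matrix (Fin m') (Fin m') D') :
    Module.finrank F D = Module.finrank F D' := by
  have : NeZero m := ⟨hm.ne'⟩
  have : NeZero m' := ⟨hm'.ne'⟩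
  have h1 := le_finrank_of_algHom ((matrixColumnAction F D' m').comp e.toAlgHom)
  have h2 := le_finrank_of_algHom ((matrixColumnAction F D m).comp e.symm.toAlgHom)
  have h3 := e.toLinearEquiv.finrank_eq
  simp only [Module.finrank_pi_fintype, Finset.sum_const, Finset.card_univ, Fintype.card_fin,
    smul_eq_mul, Module.finrank_matrix] at h1 h2 h3
  have h4 := le_antisymm h1 h2
  have hd : 0 < Module.finrank F D := Module.finrank_pos
  have h5 : m = m' := by
    have : m * (m * Module.finrank F D) = m' * (m * Module.finrank F D) := by
      rw [← mul_assoc, h3]; rw [h4]; ring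
    exact Nat.eq_of_mul_eq_mul_right (Nat.mul_pos hm hd) this
  subst h5
  exact Nat.eq_of_mul_eq_mul_left hm h4

theorem exists_matrix_algEquiv_divisionRing (F A : Type) [Field F] [Ring A] [Algebra F A]
    [IsSimpleRing A] [FiniteDimensional F A] :
    ∃ (r : ℕ) (D : Type) (_ : DivisionRing D) (_ : Algebra F D), 0 < r ∧ FiniteDimensional F D ∧
      Nonempty (A ≃ₐ[F] Matrix (Fin r) (Fin r) D) := by
  have := IsArtinianRing.of_finite F A
  obtain ⟨r, hr, D, i1, i2, i3, e⟩ := IsSimpleRing.exists_algEquiv_matrix_divisionRing_finite F A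
  exact ⟨r, D, i1, i2, Nat.pos_of_ne_zero hr.out, i3, e⟩

/-- The algebra of `a × a` matrices over `b × b` matrices is that of `a * b × a * b` matrices. -/
def matrixMatrixAlgEquiv (F A : Type*) [CommSemiring F] [Semiring A] [Algebra F A] (a b : ℕ) :
    Matrix (Fin a) (Fin a) (Matrix (Fin b) (Fin b) A) ≃ₐ[F]
      Matrix (Fin (a * b)) (Fin (a * b)) A :=
  (Matrix.compAlgEquiv (Fin a) (Fin b) A F).trans (Matrix.reindexAlgEquiv F A finProdFinEquiv)

/-- A one-dimensional division algebra is the base field. -/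
theorem isSplitAlg_of_matrix_algEquiv {F A D : Type} [Field F] [Ring A] [Algebra F A]
    [DivisionRing D] [Algebra F D] (hD : Module.finrank F D = 1) {r : ℕ} (hr : 0 < r)
    (e : A ≃ₐ[F] Matrix (Fin r) (Fin r) D) : IsSplitAlg F A := by
  have hb : Function.Bijective (algebraMap F D) := by
    refine ⟨(algebraMap F D).injective, fun d => ?_⟩
    obtain ⟨c, hc⟩ := (finrank_eq_one_iff_of_nonzero' (1 : D) one_ne_zero).1 hD d
    exact ⟨c, by rw [← hc, Algebra.algebraMap_eq_smul_one]⟩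
  exact ⟨r, hr, ⟨e.trans (AlgEquiv.ofBijective (Algebra.ofId F D) hb).symm.mapMatrix⟩⟩

theorem isSplitAlg_of_matrix {F A : Type} [Field F] [Ring A] [Algebra F A] [IsSimpleRing A]
    [FiniteDimensional F A] {a b : ℕ} (ha : 0 < a) (hb : 0 < b)
    (e : Matrix (Fin a) (Fin a) A ≃ₐ[F] Matrix (Fin b) (Fin b) F) : IsSplitAlg F A := by
  obtain ⟨r, D, _, _, hr, _, ⟨e'⟩⟩ := exists_matrix_algEquiv_divisionRing F A
  refine isSplitAlg_of_matrix_algEquiv ?_ hr e'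
  rw [finrank_eq_of_matrix_algEquiv (Nat.mul_pos ha hr) hb
    (((matrixMatrixAlgEquiv F D a r).symm.trans e'.symm.mapMatrix).trans e), Module.finrank_self]

theorem isSimpleRing_of_matrix {C : Type*} [Ring C] {b : ℕ} (hb : 0 < b)
    (h : IsSimpleRing (Matrix (Fin b) (Fin b) C)) : IsSimpleRing C := by
  have : NeZero b := ⟨hb.ne'⟩
  exact ⟨(TwoSidedIdeal.orderIsoMatrix (R := C) (n := Fin b)).isSimpleOrder⟩

theorem isSplitAlg_of_not_isUnit {F C : Type} [Field F] [Ring C] [Algebra F C] [IsSimpleRing C]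
    {p : ℕ} (hp : p.Prime) (hC : Module.finrank F C = p ^ 2) {x : C} (hx0 : x ≠ 0)
    (hx : ¬ IsUnit x) : IsSplitAlg F C := by
  have : FiniteDimensional F C :=
    FiniteDimensional.of_finrank_pos (by rw [hC]; exact pow_pos hp.pos 2)
  obtain ⟨r, D, _, _, hr, _, ⟨e⟩⟩ := exists_matrix_algEquiv_divisionRing F C
  have h := e.toLinearEquiv.finrank_eq
  simp only [hC, Module.finrank_matrix, Fintype.card_fin] at h
  have hdvd : r ∣ p := (Nat.pow_dvd_pow_iff two_ne_zero).1 ⟨_, by rw [h, sq]⟩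
  rcases (Nat.dvd_prime hp).1 hdvd with rfl | rfl
  · exfalso
    apply hx
    have hy0 : e x 0 0 ≠ 0 := fun h0 => hx0 <| (map_eq_zero_iff e e.injective).1 <| by
      ext i j
      rw [Subsingleton.elim i 0, Subsingleton.elim j 0, h0, Matrix.zero_apply]
    have hu : IsUnit (e x) := by
      refine isUnit_iff_exists.2 ⟨Matrix.of fun _ _ => (e x 0 0)⁻¹, ?_, ?_⟩ <;>
      · ext i j
        rw [Subsingleton.elim i 0, Subsingleton.elim j 0]
        simp [Matrix.mul_apply, hy0]
    simpa using hu.map e.symm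
  · refine isSplitAlg_of_matrix_algEquiv ?_ hr e
    have : 0 < r * r := Nat.mul_pos hr hr
    rw [sq] at h
    exact Nat.eq_of_mul_eq_mul_left this (by rw [← h, mul_one])

/-- The index of a central simple algebra is at most the degree of a splitting field. -/
theorem indexLE_of_isSplitAlg {F N A : Type} [Field F] [Field N] [Algebra F N]
    [FiniteDimensional F N] [Ring A] [Algebra F A] [IsSimpleRing A] [FiniteDimensional F A]
    (h : IsSplitAlg N (N ⊗[F] A)) {d : ℕ} (hd : Module.finrank F N ≤ d) : IndexLE F A d := by
  obtain ⟨s, hs, ⟨g⟩⟩ := h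
  obtain ⟨r, D, _, _, hr, _, ⟨e⟩⟩ := exists_matrix_algEquiv_divisionRing F A
  have h1 := g.toLinearEquiv.finrank_eq
  have h2 := e.toLinearEquiv.finrank_eq
  simp only [Module.finrank_baseChange, Module.finrank_matrix, Fintype.card_fin,
    Module.finrank_self, mul_one] at h1 h2
  obtain ⟨k, rfl⟩ : r ∣ s := (Nat.pow_dvd_pow_iff two_ne_zero).1
    ⟨Module.finrank F D, by rw [sq, ← h1, h2, sq]⟩
  have hD : Module.finrank F D = k ^ 2 := by
    refine Nat.eq_of_mul_eq_mul_left (Nat.mul_pos hr hr) ?_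
    rw [← h2, h1]; ring
  have : NeZero (r * k) := ⟨hs.ne'⟩
  have hle := le_finrank_of_algHom (F := F) (D := D) (N := Fin (r * k) → N) (r := r)
    ((matrixColumnAction F N (r * k)).comp <| (g.toAlgHom.restrictScalars F).comp <|
      Algebra.TensorProduct.includeRight.comp e.symm.toAlgHom)
  rw [Module.finrank_pi_fintype] at hle
  simp only [Finset.sum_const, Finset.card_univ, Fintype.card_fin, smul_eq_mul, hD] at hle
  refine ⟨k, le_trans ?_ hd, D, _, _, r, hr, ⟨e⟩, hD⟩
  refine Nat.le_of_mul_le_mul_left ?_ hs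
  calc r * k * k = r * k ^ 2 := by ring
    _ ≤ _ := hle

theorem HasIndex.pos {F A : Type} [Field F] [Ring A] [Algebra F A] [FiniteDimensional F A]
    {d : ℕ} (h : HasIndex F A d) : 0 < d := by
  obtain ⟨D, _, _, m, hm, ⟨e⟩, hD⟩ := h
  have := Module.Finite.equiv e.toLinearEquiv
  have : FiniteDimensional F D := .of_surjective
    (Matrix.entryLinearMap F D (⟨0, hm⟩ : Fin m) (⟨0, hm⟩ : Fin m)) fun f => ⟨fun _ _ => f, rfl⟩
  have : 0 < Module.finrank F D := Module.finrank_pos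
  rw [hD] at this
  exact Nat.pos_of_ne_zero fun h => by simp [h] at this

theorem HasIndex.unique {F A : Type} [Field F] [Ring A] [Algebra F A] {d d' : ℕ} (hd : 0 < d)
    (hd' : 0 < d') (h : HasIndex F A d) (h' : HasIndex F A d') : d = d' := by
  obtain ⟨D, _, _, m, hm, ⟨e⟩, hD⟩ := h
  obtain ⟨D', _, _, m', hm', ⟨e'⟩, hD'⟩ := h'
  have : FiniteDimensional F D :=
    FiniteDimensional.of_finrank_pos (by rw [hD]; exact pow_pos hd 2)
  have : FiniteDimensional F D' :=
    FiniteDimensional.of_finrank_pos (by rw [hD']; exact pow_pos hd' 2)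
  have := finrank_eq_of_matrix_algEquiv hm hm' (e.symm.trans e')
  rw [hD, hD'] at this
  exact Nat.pow_left_injective two_ne_zero this

theorem IsSplitAlg.hasIndex_one {F A : Type} [Field F] [Ring A] [Algebra F A]
    (h : IsSplitAlg F A) : HasIndex F A 1 := by
  obtain ⟨n, hn, e⟩ := h
  exact ⟨F, inferInstance, inferInstance, n, hn, e, by simp⟩

theorem IsSplitAlg.congr {F A B : Type} [Field F] [Ring A] [Algebra F A] [Ring B] [Algebra F B]
    (e : A ≃ₐ[F] B) (h : IsSplitAlg F A) : IsSplitAlg F B := by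
  obtain ⟨n, hn, ⟨g⟩⟩ := h
  exact ⟨n, hn, ⟨e.symm.trans g⟩⟩

/-- A permutation of prime order has a set of representatives for its nontrivial orbits. -/
theorem exists_orbit_transversal {X : Type*} {p : ℕ} (hp : p.Prime) (π : Equiv.Perm X)
    (hπ : π ^ p = 1) :
    ∃ T : Set X, (∀ x ∈ T, π x ≠ x) ∧
      ∀ y, π y ≠ y → ∃ i < p, (π ^ i) y ∈ T ∧ ∀ j < p, (π ^ j) y ∈ T → j = i := by
  have hper : ∀ y, π y ≠ y → Function.minimalPeriod π y = p := by
    intro y hy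
    have h1 : Function.minimalPeriod π y ∣ p := by
      apply Function.IsPeriodicPt.minimalPeriod_dvd
      rw [Function.IsPeriodicPt, ← Equiv.Perm.coe_pow, hπ]
      exact Function.isFixedPt_id y
    refine ((Nat.dvd_prime hp).1 h1).resolve_left fun h => hy ?_
    exact Function.minimalPeriod_eq_one_iff_isFixedPt.1 h
  have hzpow : ∀ k : ℤ, ∃ i < p, π ^ k = π ^ i := by
    intro k
    refine ⟨(k % p).toNat, ?_, ?_⟩
    · have := Int.emod_lt_of_pos k (Int.natCast_pos.2 hp.pos)
      have := Int.emod_nonneg k (Int.natCast_ne_zero.2 hp.ne_zero)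
      omega
    · rw [← zpow_natCast, Int.toNat_of_nonneg (Int.emod_nonneg k (Int.natCast_ne_zero.2 hp.ne_zero))]
      conv_lhs => rw [← Int.mul_ediv_add_emod k p, zpow_add, zpow_mul, zpow_natCast, hπ]
      simp
  let s : Setoid X := Equiv.Perm.SameCycle.setoid π
  let r : X → X := fun x => (Quotient.mk s x).out
  have hr : ∀ x, π.SameCycle x (r x) := fun x => (Quotient.mk_out (s := s) x).symm
  refine ⟨{x | π x ≠ x ∧ r x = x}, fun x hx => hx.1, fun y hy => ?_⟩
  obtain ⟨k, hk⟩ := hr y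
  obtain ⟨i, hi, hki⟩ := hzpow k
  rw [hki] at hk
  have hsame : ∀ j : ℕ, r ((π ^ j) y) = r y := fun j => by
    have : (Quotient.mk s ((π ^ j) y)) = Quotient.mk s y :=
      Quotient.sound (⟨-(j : ℤ), by simp⟩ : π.SameCycle ((π ^ j) y) y)
    simp only [r, this]
  refine ⟨i, hi, ⟨?_, ?_⟩, fun j hj hjT => ?_⟩
  · rw [← Equiv.Perm.mul_apply, (Commute.self_pow π i).eq, Equiv.Perm.mul_apply]
    exact fun h => hy ((π ^ i).injective h)
  · rw [hsame, hk]
  · have h1 : (π ^ j) y = (π ^ i) y := by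
      rw [hk, ← hsame j]; exact hjT.2.symm
    have := Function.iterate_injOn_Iio_minimalPeriod (f := π) (x := y)
    refine this ?_ ?_ ?_
    · simpa [hper y hy] using hj
    · simpa [hper y hy] using hi
    · simpa [← Equiv.Perm.coe_pow] using h1

theorem sum_eq_sum_fixed_add_sum_orbit {X M : Type*} [Fintype X] [DecidableEq X] [AddCommMonoid M]
    {p : ℕ} (hp : p.Prime) (π : Equiv.Perm X) (hπ : π ^ p = 1) (f : X → M) :
    ∃ T : Finset X, ∑ x, f x = ∑ x with π x = x, f x +
      ∑ i ∈ Finset.range p, ∑ x ∈ T, f ((π ^ i) x) := by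
  classical
  obtain ⟨T, hT, hT'⟩ := exists_orbit_transversal hp π⁻¹ (by rw [inv_pow, hπ, inv_one])
  refine ⟨T.toFinset, ?_⟩
  rw [← Finset.sum_filter_add_sum_filter_not Finset.univ (fun x => π x = x)]
  congr 1
  have h1 : ∀ i, ∑ x ∈ T.toFinset, f ((π ^ i) x) =
      ∑ x with π x ≠ x, if (π⁻¹ ^ i) x ∈ T then f x else 0 := by
    intro i
    rw [← Finset.sum_filter]
    refine Finset.sum_bij' (fun x _ => (π ^ i) x) (fun x _ => (π⁻¹ ^ i) x) ?_ ?_ ?_ ?_ ?_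
    · intro x hx
      have hx' := Set.mem_toFinset.1 hx
      have hne := hT x hx'
      simp only [Finset.mem_filter, Finset.mem_univ, true_and]
      refine ⟨fun h => hne ?_, ?_⟩
      swap
      · rwa [← Equiv.Perm.mul_apply, inv_pow, inv_mul_cancel]
      rw [← Equiv.Perm.mul_apply, (Commute.self_pow π i).eq, Equiv.Perm.mul_apply] at h
      rw [Equiv.Perm.inv_eq_iff_eq]
      exact ((π ^ i).injective h).symm
    · intro x hx
      simpa using (Finset.mem_filter.1 hx).2
    · intro x _; simp
    · intro x _; simp
    · intro x _; simp
  simp_rw [h1]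
  rw [Finset.sum_comm]
  refine Finset.sum_congr rfl fun x hx => ?_
  have hx' : π⁻¹ x ≠ x := fun h => (Finset.mem_filter.1 hx).2 (Equiv.Perm.inv_eq_iff_eq.1 h).symm
  obtain ⟨i, hi, hiT, huniq⟩ := hT' x hx'
  rw [Finset.sum_eq_single i]
  · rw [if_pos hiT]
  · intro j hj hji
    rw [if_neg fun h => hji (huniq j (Finset.mem_range.1 hj) h)]
  · intro h; exact absurd (Finset.mem_range.2 hi) h

/-- The permutation operator on functions attached to a permutation. -/
def permOperator (R : Type*) [CommSemiring R] {X : Type*} (π : Equiv.Perm X) :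
    Module.End R (X → R) := LinearMap.funLeft R R π

theorem permOperator_pow_apply {R : Type*} [CommSemiring R] {X : Type*} (π : Equiv.Perm X) (i : ℕ)
    (f : X → R) (x : X) : (permOperator R π ^ i) f x = f ((π ^ i) x) := by
  induction i generalizing f with
  | zero => simp
  | succ i ih => rw [pow_succ, Module.End.mul_apply, ih, pow_succ']; rfl

theorem permOperator_pow_eq_one {R : Type*} [CommSemiring R] {X : Type*} {π : Equiv.Perm X}
    {p : ℕ} (hπ : π ^ p = 1) : permOperator R π ^ p = 1 :=
  LinearMap.ext fun f => funext fun x => by rw [permOperator_pow_apply, hπ]; rfl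

/-- In characteristic `p`, the degree zero Tate cohomology of a permutation representation of
a cyclic group of order `p` has dimension the number of fixed points. -/
theorem finrank_ker_permOperator {R : Type*} [Field R] {X : Type*} [Fintype X] [DecidableEq X]
    {p : ℕ} (hp : p.Prime) [CharP R p] (π : Equiv.Perm X) (hπ : π ^ p = 1) :
    Module.finrank R (LinearMap.ker (permOperator R π - 1)) =
      Fintype.card {x // π x = x} +
        Module.finrank R (LinearMap.range (∑ i ∈ Finset.range p, permOperator R π ^ i)) := by
  classical
  set P := permOperator R π
  set N := ∑ i ∈ Finset.range p, P ^ i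
  have hN : ∀ g x, N g x = ∑ i ∈ Finset.range p, g ((π ^ i) x) := fun g x => by
    simp [N, P, LinearMap.sum_apply, permOperator_pow_apply]
  have hker : ∀ f, f ∈ LinearMap.ker (P - 1) ↔ ∀ x, f (π x) = f x := fun f => by
    rw [LinearMap.mem_ker, LinearMap.sub_apply, sub_eq_zero, funext_iff]; rfl
  have hle : LinearMap.range N ≤ LinearMap.ker (P - 1) := by
    rw [LinearMap.range_le_ker_iff, ← Module.End.mul_eq_comp, mul_geom_sum,
      permOperator_pow_eq_one hπ, sub_self]
  let r : LinearMap.ker (P - 1) →ₗ[R] ({x // π x = x} → R) :=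
    LinearMap.funLeft R R Subtype.val ∘ₗ (LinearMap.ker (P - 1)).subtype
  have hr : Function.Surjective r := by
    intro g
    refine ⟨⟨fun x => if h : π x = x then g ⟨x, h⟩ else 0, (hker _).2 fun x => ?_⟩, ?_⟩
    · by_cases h : π x = x
      · simp [h]
      · have : π (π x) ≠ π x := fun h' => h (π.injective h')
        simp [h]
    · funext x
      simp [r, LinearMap.funLeft_apply, x.2]
  have hkr : LinearMap.ker r = (LinearMap.range N).submoduleOf (LinearMap.ker (P - 1)) := by
    ext ⟨f, hf⟩
    rw [Submodule.submoduleOf, Submodule.mem_comap, LinearMap.mem_ker]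
    have hf' := (hker f).1 hf
    have hfp : ∀ i x, f ((π ^ i) x) = f x := fun i x => by
      induction i with
      | zero => simp
      | succ i ih => rw [pow_succ', Equiv.Perm.mul_apply, hf', ih]
    constructor
    · intro h
      obtain ⟨T, hT, hT'⟩ := exists_orbit_transversal hp π hπ
      refine ⟨fun x => if x ∈ T then f x else 0, funext fun x => ?_⟩
      rw [hN]
      change _ = f x
      by_cases hx : π x = x
      · have h0 : f x = 0 := congrFun h ⟨x, hx⟩
        rw [h0]
        refine Finset.sum_eq_zero fun i _ => ?_
        simp [hfp, h0]
      · obtain ⟨i, hi, hiT, huniq⟩ := hT' x hx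
        rw [Finset.sum_eq_single i]
        · simp [hiT, hfp]
        · intro j hj hji
          rw [if_neg fun h => hji (huniq j (Finset.mem_range.1 hj) h)]
        · intro h; exact absurd (Finset.mem_range.2 hi) h
    · rintro ⟨g, hg⟩
      funext ⟨x, hx⟩
      have hx' : ∀ i, (π ^ i) x = x := fun i => by
        induction i with
        | zero => simp
        | succ i ih => rw [pow_succ', Equiv.Perm.mul_apply, ih, hx]
      change f x = 0
      change N g = f at hg
      rw [← hg, hN]
      simp [hx']
  have h1 := LinearMap.finrank_range_add_finrank_ker r
  rw [LinearMap.range_eq_top.2 hr, finrank_top, Module.finrank_pi, hkr,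
    (Submodule.submoduleOfEquivOfLe hle).finrank_eq] at h1
  exact h1.symm

theorem LinearIndependent.algebraMap_comp {F Ω κ ι : Type*} [Field F] [Field Ω] [Algebra F Ω]
    [Finite κ] [Finite ι] {v : ι → κ → F} (hv : LinearIndependent F v) :
    LinearIndependent Ω fun i k => algebraMap F Ω (v i k) := by
  classical
  have := Fintype.ofFinite κ
  have := Fintype.ofFinite ι
  let V : Matrix κ ι F := Matrix.of fun k i => v i k
  have hV : Function.Injective V.toLin' := by
    rw [Fintype.linearIndependent_iff] at hv
    refine (injective_iff_map_eq_zero _).2 fun c hc => funext fun i => hv c ?_ i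
    rw [← hc]
    funext k
    simp [V, Matrix.mulVec, dotProduct, mul_comm]
  obtain ⟨g, hg⟩ := V.toLin'.exists_leftInverse_of_injective (LinearMap.ker_eq_bot.2 hV)
  have hGV : LinearMap.toMatrix' g * V = 1 := by
    rw [← LinearMap.toMatrix'_toLin' V, ← LinearMap.toMatrix'_comp, hg, LinearMap.toMatrix'_id]
  have hGV' : (LinearMap.toMatrix' g).map (algebraMap F Ω) * V.map (algebraMap F Ω) = 1 := by
    rw [← Matrix.map_mul, hGV, Matrix.map_one _ (map_zero _) (map_one _)]
  rw [Fintype.linearIndependent_iff]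
  intro c hc i
  have h0 : (V.map (algebraMap F Ω)).mulVec c = 0 := by
    rw [← hc]
    funext k
    simp [V, Matrix.mulVec, dotProduct, mul_comm]
  rw [← Matrix.one_mulVec c, ← hGV', ← Matrix.mulVec_mulVec, h0, Matrix.mulVec_zero]
  rfl

theorem finrank_ker_map_algebraMap {F Ω : Type*} [Field F] [Field Ω] [Algebra F Ω] {m : ℕ}
    (a : Matrix (Fin m) (Fin m) F) :
    Module.finrank Ω (LinearMap.ker (a.map (algebraMap F Ω)).toLin') =
        Module.finrank F (LinearMap.ker a.toLin') ∧
      Module.finrank Ω (LinearMap.range (a.map (algebraMap F Ω)).toLin') =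
        Module.finrank F (LinearMap.range a.toLin') := by
  have hmap : ∀ v : Fin m → F, (a.map (algebraMap F Ω)).toLin' (fun k => algebraMap F Ω (v k)) =
      fun k => algebraMap F Ω (a.toLin' v k) := by
    intro v
    funext k
    simp [Matrix.mulVec, dotProduct]
  have key : ∀ (S : Submodule F (Fin m → F)) (S' : Submodule Ω (Fin m → Ω)),
      (∀ v ∈ S, (fun k => algebraMap F Ω (v k)) ∈ S') →
      Module.finrank F S ≤ Module.finrank Ω S' := by
    intro S S' h
    let b := Module.finBasis F S
    have hb : LinearIndependent F fun i => (b i : Fin m → F) :=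
      b.linearIndependent.map' S.subtype (Submodule.ker_subtype S)
    have h2 : LinearIndependent Ω fun i => (⟨_, h (b i) (b i).2⟩ : S') :=
      LinearIndependent.of_comp S'.subtype (hb.algebraMap_comp (Ω := Ω))
    simpa using h2.fintype_card_le_finrank
  have h1 := key (LinearMap.ker a.toLin') (LinearMap.ker (a.map (algebraMap F Ω)).toLin') (by
    intro v hv
    rw [LinearMap.mem_ker] at hv ⊢
    rw [hmap, hv]
    funext k
    simp)
  have h2 := key (LinearMap.range a.toLin') (LinearMap.range (a.map (algebraMap F Ω)).toLin') (by
    rintro _ ⟨v, rfl⟩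
    exact ⟨_, hmap v⟩)
  have h3 := LinearMap.finrank_range_add_finrank_ker a.toLin'
  have h4 := LinearMap.finrank_range_add_finrank_ker (a.map (algebraMap F Ω)).toLin'
  simp only [Module.finrank_fin_fun] at h3 h4
  omega

open Polynomial in
/-- An operator whose `p`-th power is a scalar that is not a `p`-th power has a formal
derivation with respect to it. -/
theorem exists_mul_sub_mul_eq_one {F W : Type*} [Field F] {p : ℕ} (hp : p.Prime) [CharP F p]
    [AddCommGroup W] [Module F W] (e : Module.End F W) (l : F)
    (he : e ^ p = algebraMap F (Module.End F W) l) (hl : ∀ μ : F, μ ^ p ≠ l) :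
    ∃ h : Module.End F W, h * e - e * h = 1 := by
  let f : F[X] := X ^ p - C l
  have hf : Irreducible f := X_pow_sub_C_irreducible_of_prime hp hl
  have : Fact (Irreducible f) := ⟨hf⟩
  have hef : aeval e f = 0 := by simp [f, he]
  let φ : AdjoinRoot f →ₐ[F] Module.End F W := Ideal.Quotient.liftₐ _ (aeval e) fun a ha => by
    obtain ⟨c, rfl⟩ := Ideal.mem_span_singleton.1 ha
    rw [map_mul, hef, zero_mul]
  have hφ : φ (AdjoinRoot.root f) = e := aeval_X e
  let _ : Module (AdjoinRoot f) W := Module.compHom W φ.toRingHom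
  have hsmul : ∀ (d : AdjoinRoot f) (w : W), d • w = φ d w := fun _ _ => rfl
  have : IsScalarTower F (AdjoinRoot f) W := ⟨fun c d w => by simp [hsmul]⟩
  obtain ⟨δ, hδ⟩ : ∃ δ : AdjoinRoot f →ₗ[F] AdjoinRoot f,
      ∀ d, δ (AdjoinRoot.root f * d) = d + AdjoinRoot.root f * δ d := by
    have hker : ∀ g : F[X], AdjoinRoot.mkₐ f g = 0 → AdjoinRoot.mkₐ f (derivative' g) = 0 := by
      intro g hg
      obtain ⟨c, rfl⟩ := AdjoinRoot.mk_eq_zero.1 hg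
      rw [AdjoinRoot.coe_mkₐ, AdjoinRoot.mk_eq_zero]
      simp [f, derivative_X_pow]
    let δ := Derivation.liftOfSurjective (f := AdjoinRoot.mkₐ f) AdjoinRoot.mk_surjective hker
    have hδX : δ (AdjoinRoot.root f) = 1 := by
      have := Derivation.liftOfSurjective_apply (f := AdjoinRoot.mkₐ f)
        AdjoinRoot.mk_surjective hker X
      rw [AdjoinRoot.coe_mkₐ, AdjoinRoot.mk_X] at this
      rw [this]
      simp
    refine ⟨δ.toLinearMap, fun d => ?_⟩
    change δ _ = _ + _ * δ d
    rw [Derivation.leibniz, hδX, smul_eq_mul, smul_eq_mul, mul_one, add_comm]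
  let b := Module.Basis.ofVectorSpace (AdjoinRoot f) W
  let r := b.repr.restrictScalars F
  refine ⟨r.symm.toLinearMap ∘ₗ Finsupp.mapRange.linearMap δ ∘ₗ r.toLinearMap, ?_⟩
  ext w
  have hew : ∀ w, e w = AdjoinRoot.root f • w := fun w => by rw [hsmul, hφ]
  rw [LinearMap.sub_apply, Module.End.mul_apply, Module.End.mul_apply, hew, hew, sub_eq_iff_eq_add]
  apply b.repr.injective
  ext i
  simp [r, hδ]

/-- Uniqueness of the simple module of a matrix algebra. -/
theorem exists_linearEquiv_of_matrix_algHom {F Ω V : Type*} [Field F] [Field Ω] [Algebra F Ω]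
    [AddCommGroup V] [Module Ω V] [FiniteDimensional Ω V] [Nontrivial V] [Module F V] [IsScalarTower F Ω V]
    {m : ℕ} (hm : Module.finrank Ω V = m)
    (χ : Matrix (Fin m) (Fin m) F →ₐ[F] Module.End Ω V) :
    ∃ T : (Fin m → Ω) ≃ₗ[Ω] V, ∀ a v, T ((a.map (algebraMap F Ω)).toLin' v) = χ a (T v) := by
  have hm0 : 0 < m := hm ▸ Module.finrank_pos
  let o : Fin m := ⟨0, hm0⟩
  have hz : ∃ z, χ (Matrix.single o o 1) z ≠ 0 := by
    by_contra! h
    have h0 : χ (Matrix.single o o 1) = 0 := LinearMap.ext h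
    have h1 : χ 1 = 0 := by
      rw [← Matrix.sum_single_one, map_sum]
      refine Finset.sum_eq_zero fun i _ => ?_
      have : Matrix.single i i (1 : F) =
          Matrix.single i o 1 * Matrix.single o o 1 * Matrix.single o i 1 := by simp
      rw [this, map_mul, map_mul, h0, mul_zero, zero_mul]
    rw [map_one] at h1
    exact one_ne_zero h1
  obtain ⟨z, hz⟩ := hz
  let T := Fintype.linearCombination Ω fun i => χ (Matrix.single i o 1) z
  have hT : Function.Injective T := by
    refine (injective_iff_map_eq_zero _).2 fun c hc => funext fun i => ?_
    have := congrArg (χ (Matrix.single o i 1)) hc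
    rw [Fintype.linearCombination_apply, map_sum, map_zero, Finset.sum_eq_single i] at this
    · rw [map_smul, ← Module.End.mul_apply, ← map_mul, Matrix.single_mul_single_same, one_mul] at this
      exact (smul_eq_zero.1 this).resolve_right hz
    · intro j _ hj
      rw [map_smul, ← Module.End.mul_apply, ← map_mul,
        Matrix.single_mul_single_of_ne _ _ _ _ hj.symm]
      simp
    · simp
  refine ⟨LinearEquiv.ofInjectiveOfFinrankEq T hT (by simp [hm]), fun a v => ?_⟩
  change T _ = χ a (T v)
  have h1 : ∀ k, a * Matrix.single k o 1 = ∑ i, a i k • Matrix.single i o 1 := by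
    intro k
    ext i j
    rw [Matrix.sum_apply, Finset.sum_eq_single i]
    · by_cases hj : o = j
      · subst hj; simp
      · simp [Matrix.mul_apply, hj]
    · intro i' _ hi'
      simp [hi']
    · simp
  simp only [T, Fintype.linearCombination_apply, map_sum, map_smul]
  simp_rw [← Module.End.mul_apply, ← map_mul, h1, map_sum, map_smul, LinearMap.sum_apply,
    LinearMap.smul_apply, Matrix.toLin'_apply, Matrix.mulVec, dotProduct, Matrix.map_apply,
    Finset.sum_smul, Finset.smul_sum]
  rw [Finset.sum_comm]
  refine Finset.sum_congr rfl fun k _ => Finset.sum_congr rfl fun i _ => ?_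
  rw [mul_comm, mul_smul, algebraMap_smul]

theorem exists_matrix_conj_permOperator {F Ω X : Type*} [Field F] [Field Ω] [Algebra F Ω]
    {p : ℕ} (hp : p.Prime) [CharP F p] {m : ℕ} [Fintype X] [DecidableEq X]
    (hX : Fintype.card X = m) (π : Equiv.Perm X) (hπ : π ^ p = 1) (x₀ : X) (hx₀ : π x₀ = x₀)
    (χ : Matrix (Fin m) (Fin m) F →ₐ[F] Module.End Ω (X → Ω))
    (σ : Matrix (Fin m) (Fin m) F ≃ₐ[F] Matrix (Fin m) (Fin m) F)
    (hσ : ∀ a, χ (σ a) * permOperator Ω π = permOperator Ω π * χ a) :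
    ∃ (e : Matrix (Fin m) (Fin m) F) (T : (Fin m → Ω) ≃ₗ[Ω] (X → Ω)), e ^ p = 1 ∧
      (∀ a, σ a * e = e * a) ∧
      ∀ v, T ((e.map (algebraMap F Ω)).toLin' v) = permOperator Ω π (T v) := by
  have : Nonempty X := ⟨x₀⟩
  have : CharP Ω p := charP_of_injective_algebraMap (algebraMap F Ω).injective p
  obtain ⟨T, hT⟩ := exists_linearEquiv_of_matrix_algHom (by simp [hX]) χ
  obtain ⟨S, hS⟩ := AlgEquiv.eq_linearEquivConjAlgEquiv
    ((Matrix.toLinAlgEquiv'.symm.trans σ).trans Matrix.toLinAlgEquiv')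
  set e := LinearMap.toMatrix' S.toLinearMap with he
  set g := LinearMap.toMatrix' S.symm.toLinearMap with hg
  have hge : g * e = 1 := by
    rw [he, hg, ← LinearMap.toMatrix'_comp]; simp
  have heg : e * g = 1 := mul_eq_one_comm.1 hge
  have hσe : ∀ a, σ a * e = e * a := by
    intro a
    have h := AlgEquiv.congr_fun hS (Matrix.toLinAlgEquiv' a)
    simp only [AlgEquiv.trans_apply, AlgEquiv.symm_apply_apply] at h
    apply Matrix.toLin'.injective
    rw [Matrix.toLin'_mul, Matrix.toLin'_mul, he, Matrix.toLin'_toMatrix']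
    refine LinearMap.ext fun v => ?_
    have := LinearMap.congr_fun h (S v)
    simpa using this
  let mp : Matrix (Fin m) (Fin m) F →+* Matrix (Fin m) (Fin m) Ω := (algebraMap F Ω).mapMatrix
  let c : Module.End Ω (X → Ω) ≃ₐ[Ω] Matrix (Fin m) (Fin m) Ω :=
    (T.symm.conjAlgEquiv Ω).trans LinearMap.toMatrixAlgEquiv'
  have hcT : ∀ (a : Matrix (Fin m) (Fin m) Ω) (f : Module.End Ω (X → Ω)),
      (∀ v, T (a.toLin' v) = f (T v)) ↔ c f = a := by
    intro a f
    rw [AlgEquiv.trans_apply, ← AlgEquiv.eq_symm_apply, LinearMap.toMatrixAlgEquiv'_symm]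
    constructor
    · intro h
      refine LinearMap.ext fun v => T.injective ?_
      simp [← h v]
    · intro h v
      have h1 := congrArg T (LinearMap.congr_fun h v)
      simpa using h1.symm
  have hcχ : ∀ a, c (χ a) = mp a := fun a => (hcT _ _).1 (hT a)
  set P := permOperator Ω π with hP
  set Q := c P with hQ
  have hQp : Q ^ p = 1 := by rw [hQ, ← map_pow, permOperator_pow_eq_one hπ, map_one]
  have hmQ : ∀ a, mp (σ a) * Q = Q * mp a := fun a => by
    rw [hQ, ← hcχ, ← hcχ, ← map_mul, ← map_mul, hσ]
  have hcomm : ∀ a, Commute (mp a) (mp g * Q) := fun a => by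
    have h1 : g * σ a = a * g := by
      rw [← mul_one (g * σ a), ← heg, ← mul_assoc, mul_assoc g, hσe, ← mul_assoc, hge, one_mul]
    rw [commute_iff_eq, mul_assoc, ← hmQ, ← mul_assoc, ← mul_assoc, ← map_mul, ← map_mul, h1]
  obtain ⟨s, hs⟩ := Matrix.mem_range_scalar_of_commute_single (M := mp g * Q) fun i j _ => by
    have := hcomm (Matrix.single i j 1)
    simpa [mp, RingHom.mapMatrix_apply, Matrix.map_single] using this
  have hQs : Q = s • mp e := by
    rw [← one_mul Q, ← map_one mp, ← heg, map_mul, mul_assoc, ← hs, Matrix.scalar_apply,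
      ← Matrix.smul_one_eq_diagonal, mul_smul_comm, mul_one]
  have hse : s ^ p • mp (e ^ p) = 1 := by
    rw [map_pow, ← smul_pow, ← hQs, hQp]
  have hm0 : 0 < m := hX ▸ Fintype.card_pos
  let o : Fin m := ⟨0, hm0⟩
  set l := (e ^ p) o o with hl
  have hsl : s ^ p * algebraMap F Ω l = 1 := by
    have := congrFun (congrFun hse o) o
    simpa [mp] using this
  have hs0 : s ≠ 0 := by
    rintro rfl
    rw [zero_pow hp.ne_zero, zero_mul] at hsl
    exact zero_ne_one hsl
  have hel : e ^ p = algebraMap F _ l := by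
    have hinj : Function.Injective mp := Matrix.map_injective (algebraMap F Ω).injective
    apply hinj
    have h2 : mp (algebraMap F _ l) = algebraMap F Ω l • 1 := by
      rw [Algebra.algebraMap_eq_smul_one]
      ext i j
      by_cases hij : i = j <;> simp [mp, hij]
    rw [h2, ← hse, smul_smul, mul_comm, hsl, one_smul]
  obtain ⟨μ, hμ⟩ : ∃ μ : F, μ ^ p = l := by
    by_contra! hno
    obtain ⟨h, hh⟩ := exists_mul_sub_mul_eq_one hp e.toLin' l (by
      rw [← Matrix.toLin'_pow, hel]
      simp [Algebra.algebraMap_eq_smul_one, Module.End.one_eq_id]) hno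
    set H := LinearMap.toMatrix' h
    have hH : H * e - e * H = 1 := by
      have := congrArg LinearMap.toMatrix' hh
      rw [map_sub, LinearMap.toMatrix'_mul, LinearMap.toMatrix'_mul,
        LinearMap.toMatrix'_toLin', LinearMap.toMatrix'_one] at this
      exact this
    have hHQ : mp H * Q - Q * mp H = s • 1 := by
      rw [hQs, mul_smul_comm, smul_mul_assoc, ← smul_sub, ← map_mul mp, ← map_mul mp, ← map_sub, hH,
        map_one]
    have hHP : c.symm (mp H) * P - P * c.symm (mp H) = s • 1 := by
      apply c.injective
      simpa using hHQ
    have h2 := congrFun (LinearMap.congr_fun hHP (Pi.single x₀ 1)) x₀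
    have hP₀ : P (Pi.single x₀ 1) = Pi.single x₀ 1 := by
      funext x
      change (Pi.single x₀ 1 : X → Ω) (π x) = _
      simp only [Pi.single_apply]
      congr 1
      conv_lhs => rw [← hx₀]
      rw [π.injective.eq_iff]
    rw [LinearMap.sub_apply, Module.End.mul_apply, Module.End.mul_apply, hP₀] at h2
    have hP₁ : ∀ f : X → Ω, P f x₀ = f x₀ := fun f => congrArg f hx₀
    rw [Pi.sub_apply, hP₁, sub_self] at h2
    exact hs0 (by simpa using h2.symm)
  have hsμ : s * algebraMap F Ω μ = 1 := by
    have := Fact.mk hp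
    apply frobenius_inj Ω p
    rw [frobenius_def, frobenius_def, mul_pow, ← map_pow, hμ, hsl, one_pow]
  have hμ0 : μ ≠ 0 := by
    rintro rfl
    simp at hsμ
  refine ⟨μ⁻¹ • e, T, ?_, fun a => ?_, (hcT _ _).2 ?_⟩
  · rw [smul_pow, hel, ← hμ, Algebra.algebraMap_eq_smul_one, smul_smul, ← mul_pow,
      inv_mul_cancel₀ hμ0, one_pow, one_smul]
  · rw [mul_smul_comm, smul_mul_assoc, hσe]
  · change Q = mp (μ⁻¹ • e)
    have h1 : mp (μ⁻¹ • e) = algebraMap F Ω μ⁻¹ • mp e := by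
      ext i j
      simp [mp]
    rw [h1, hQs, map_inv₀, eq_inv_of_mul_eq_one_left hsμ]

theorem finrank_ker_matrix_of_conj {F Ω X : Type*} [Field F] [Field Ω] [Algebra F Ω]
    {p : ℕ} (hp : p.Prime) [CharP F p] {m : ℕ} [Fintype X] [DecidableEq X]
    (π : Equiv.Perm X) (hπ : π ^ p = 1) (e : Matrix (Fin m) (Fin m) F)
    (T : (Fin m → Ω) ≃ₗ[Ω] (X → Ω))
    (hT : ∀ v, T ((e.map (algebraMap F Ω)).toLin' v) = permOperator Ω π (T v)) :
    Module.finrank F (LinearMap.ker (e.toLin' - 1)) =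
      Fintype.card {x // π x = x} +
        Module.finrank F (LinearMap.range (∑ i ∈ Finset.range p, e.toLin' ^ i)) := by
  have : CharP Ω p := charP_of_injective_algebraMap (algebraMap F Ω).injective p
  set P := permOperator Ω π
  set N : Matrix (Fin m) (Fin m) F := ∑ i ∈ Finset.range p, e ^ i
  have hN : ∑ i ∈ Finset.range p, e.toLin' ^ i = N.toLin' := by
    simp [N, map_sum, Matrix.toLin'_pow]
  have hE : e.toLin' - 1 = (e - 1).toLin' := by
    simp [map_sub, Module.End.one_eq_id]
  have hEm : ((e - 1).map (algebraMap F Ω)).toLin' = (e.map (algebraMap F Ω)).toLin' - 1 := by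
    rw [Matrix.map_sub _ (by simp), Matrix.map_one _ (map_zero _) (map_one _), map_sub,
      Matrix.toLin'_one, Module.End.one_eq_id]
  have hNm : (N.map (algebraMap F Ω)).toLin' =
      ∑ i ∈ Finset.range p, (e.map (algebraMap F Ω)).toLin' ^ i := by
    have h1 : N.map (algebraMap F Ω) = ∑ i ∈ Finset.range p, (e.map (algebraMap F Ω)) ^ i := by
      change (algebraMap F Ω).mapMatrix N = _
      rw [map_sum]
      exact Finset.sum_congr rfl fun i _ => map_pow (algebraMap F Ω).mapMatrix e i
    rw [h1, map_sum]
    simp [Matrix.toLin'_pow]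
  have hTpow : ∀ i v, T (((e.map (algebraMap F Ω)).toLin' ^ i) v) = (P ^ i) (T v) := by
    intro i
    induction i with
    | zero => simp
    | succ i ih => intro v; rw [pow_succ, Module.End.mul_apply, ih, hT, pow_succ]; rfl
  rw [hN, hE, ← (finrank_ker_map_algebraMap (Ω := Ω) (e - 1)).1,
    ← (finrank_ker_map_algebraMap (Ω := Ω) N).2, hEm, hNm]
  have h := finrank_ker_permOperator (R := Ω) hp π hπ
  have hk : (LinearMap.ker ((e.map (algebraMap F Ω)).toLin' - 1)).map T.toLinearMap =
      LinearMap.ker (P - 1) := by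
    ext f
    rw [Submodule.mem_map_equiv, LinearMap.mem_ker, LinearMap.mem_ker, LinearMap.sub_apply,
      LinearMap.sub_apply, ← T.map_eq_zero_iff, map_sub, hT]
    simp
  have hr : (LinearMap.range (∑ i ∈ Finset.range p, (e.map (algebraMap F Ω)).toLin' ^ i)).map
      T.toLinearMap = LinearMap.range (∑ i ∈ Finset.range p, P ^ i) := by
    have hTN : T.toLinearMap ∘ₗ (∑ i ∈ Finset.range p, (e.map (algebraMap F Ω)).toLin' ^ i) =
        (∑ i ∈ Finset.range p, P ^ i) ∘ₗ T.toLinearMap := by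
      refine LinearMap.ext fun v => ?_
      simp only [LinearMap.comp_apply, LinearMap.sum_apply, map_sum]
      exact Finset.sum_congr rfl fun i _ => hTpow i v
    rw [← LinearMap.range_comp, hTN, LinearMap.range_comp, T.range, Submodule.map_top]
  rw [← T.finrank_map_eq, ← T.finrank_map_eq, hk, hr]
  exact h

theorem exists_ringHom_tate {F A W : Type*} [Field F] [Ring A] [Algebra F A] [AddCommGroup W]
    [Module F W] [FiniteDimensional F W] {p n : ℕ} (e : Module.End F W) (he : e ^ p = 1)
    (hn : Module.finrank F (LinearMap.ker (e - 1)) =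
      n + Module.finrank F (LinearMap.range (∑ i ∈ Finset.range p, e ^ i)))
    (t : A → Module.End F W) (ht0 : t 0 = 0) (htF : ∀ f, t (algebraMap F A f) = algebraMap F _ (f ^ p))
    (htm : ∀ a b, t (a * b) = t a * t b) (hte : ∀ a, Commute (t a) e)
    (hta : ∀ a b, ∃ (y : Module.End F W) (z : ℕ → Module.End F W),
      (∀ i, z i * e ^ i = e ^ i * y) ∧ t (a + b) = t a + t b + ∑ i ∈ Finset.range p, z i) :
    ∃ ρ : A →+* Matrix (Fin n) (Fin n) F, ∀ f, ρ (algebraMap F A f) = algebraMap F _ (f ^ p) := by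
  set N := ∑ i ∈ Finset.range p, e ^ i
  set V := LinearMap.ker (e - 1)
  have hle : LinearMap.range N ≤ V := by
    rw [LinearMap.range_le_ker_iff, ← Module.End.mul_eq_comp, mul_geom_sum, he, sub_self]
  set R := (LinearMap.range N).submoduleOf V
  have hU : Module.finrank F (V ⧸ R) = n := by
    have h1 := Submodule.finrank_quotient_add_finrank R
    rw [(Submodule.submoduleOfEquivOfLe hle).finrank_eq] at h1
    omega
  have htN : ∀ a, Commute (t a) N := fun a =>
    Commute.sum_right _ _ _ fun i _ => (hte a).pow_right i
  have hV : ∀ a, ∀ w ∈ V, t a w ∈ V := by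
    intro a w hw
    have h1 : (e - 1) (t a w) = t a ((e - 1) w) := by
      rw [← Module.End.mul_apply, ← Module.End.mul_apply, ((hte a).sub_right (Commute.one_right _)).eq]
    rw [LinearMap.mem_ker] at hw ⊢
    rw [h1, hw, map_zero]
  have hR : ∀ a, R ≤ R.comap ((t a).restrict (hV a)) := by
    rintro a ⟨w, hw⟩ ⟨v, hv⟩
    refine ⟨t a v, ?_⟩
    change N v = w at hv
    change N (t a v) = t a w
    rw [← hv, ← Module.End.mul_apply, ← Module.End.mul_apply, (htN a).eq]
  have hVe : ∀ i, ∀ w ∈ V, (e ^ i) w = w := by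
    intro i w hw
    have : e w = w := by simpa [V, sub_eq_zero] using hw
    induction i with
    | zero => simp
    | succ i ih => rw [pow_succ, Module.End.mul_apply, this, ih]
  let q : A → Module.End F (V ⧸ R) := fun a => R.mapQ R ((t a).restrict (hV a)) (hR a)
  have hq : ∀ a (w : V), q a (R.mkQ w) = R.mkQ ⟨t a w, hV a w w.2⟩ := fun a w => rfl
  have hqext : ∀ f g : Module.End F (V ⧸ R), (∀ w, f (R.mkQ w) = g (R.mkQ w)) → f = g :=
    fun f g h => Submodule.linearMap_qext _ (LinearMap.ext h)
  have hqF : ∀ f, q (algebraMap F A f) = algebraMap F _ (f ^ p) := fun f => hqext _ _ fun w => by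
    rw [hq, Module.algebraMap_end_apply, ← map_smul]
    congr 1
    ext1
    change t (algebraMap F A f) w = f ^ p • (w : W)
    rw [htF, Module.algebraMap_end_apply]
  let ρ : A →+* Module.End F (V ⧸ R) :=
    { toFun := q
      map_one' := by simpa using hqF 1
      map_zero' := hqext _ _ fun w => by
        rw [hq, LinearMap.zero_apply, ← map_zero R.mkQ]
        congr 1
        ext1
        simp [ht0]
      map_mul' := fun a b => hqext _ _ fun w => by
        rw [Module.End.mul_apply, hq, hq, hq]
        simp [htm]
      map_add' := fun a b => hqext _ _ fun w => by
        obtain ⟨y, z, hz, hab⟩ := hta a b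
        rw [LinearMap.add_apply, hq, hq, hq, ← map_add, ← sub_eq_zero, ← map_sub,
          Submodule.mkQ_apply, Submodule.Quotient.mk_eq_zero]
        refine ⟨y w, ?_⟩
        change N (y w) = t (a + b) w - (t a w + t b w)
        rw [hab]
        simp only [LinearMap.add_apply, LinearMap.sum_apply, N, add_sub_cancel_left]
        refine Finset.sum_congr rfl fun i _ => ?_
        rw [← Module.End.mul_apply, ← hz, Module.End.mul_apply, hVe i w w.2] }
  let b := Module.finBasisOfFinrankEq F (V ⧸ R) hU
  refine ⟨(LinearMap.toMatrixAlgEquiv b : _ →+* _).comp ρ, fun f => ?_⟩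
  change LinearMap.toMatrixAlgEquiv b (q _) = _
  rw [hqF, AlgEquiv.commutes]

/-- Permutation of tuples induced by a permutation of the indices. -/
def tupleShift {ι : Type*} (τ : Equiv.Perm ι) (Y : Type*) : Equiv.Perm (ι → Y) :=
  Equiv.arrowCongr τ.symm (Equiv.refl Y)

theorem tupleShift_apply {ι Y : Type*} (τ : Equiv.Perm ι) (x : ι → Y) (i : ι) :
    tupleShift τ Y x i = x (τ i) := rfl

theorem tupleShift_pow_apply {ι Y : Type*} (τ : Equiv.Perm ι) (k : ℕ) (x : ι → Y) (i : ι) :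
    (tupleShift τ Y ^ k) x i = x ((τ ^ k) i) := by
  induction k generalizing x with
  | zero => rfl
  | succ k ih => rw [pow_succ, Equiv.Perm.mul_apply, ih, tupleShift_apply, pow_succ']; rfl

theorem tupleShift_pow_eq_one {ι Y : Type*} {τ : Equiv.Perm ι} {k : ℕ} (hτ : τ ^ k = 1) :
    tupleShift τ Y ^ k = 1 := by
  ext x i
  rw [tupleShift_pow_apply, hτ]
  rfl

theorem tupleShift_addRight_eq_self_iff {p : ℕ} [NeZero p] {Y : Type*} (x : Fin p → Y) :
    tupleShift (Equiv.addRight 1) Y x = x ↔ ∃ y, x = fun _ => y := by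
  constructor
  · intro h
    have h1 : ∀ i, x (i + 1) = x i := fun i => congrFun h i
    have h2 : ∀ k : ℕ, x (Fin.ofNat p k) = x 0 := by
      intro k
      induction k with
      | zero => rfl
      | succ k ih =>
        have h3 := h1 (Fin.ofNat p k)
        rw [ih] at h3
        rw [← h3]
        congr 1
        simp [Fin.ext_iff, Fin.val_add]
    refine ⟨x 0, funext fun i => ?_⟩
    rw [← h2 i]
    congr 1
    simp
  · rintro ⟨y, rfl⟩
    rfl

theorem addRight_one_pow_eq_one {p : ℕ} [NeZero p] : (Equiv.addRight (1 : Fin p)) ^ p = 1 := by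
  have h : ∀ k : ℕ, ∀ i : Fin p, ((Equiv.addRight (1 : Fin p)) ^ k) i = i + Fin.ofNat p k := by
    intro k
    induction k with
    | zero => intro i; simp
    | succ k ih =>
      intro i
      rw [pow_succ', Equiv.Perm.mul_apply, ih]
      simp [Fin.ext_iff, Fin.val_add, add_assoc]
  refine Equiv.ext fun i => ?_
  rw [h]
  simp

/-- Permutation of the factors of a tensor power. -/
noncomputable def tensorPowerPerm (F A : Type*) [Field F] [Ring A] [Algebra F A] {ι : Type*}
    (τ : Equiv.Perm ι) :
    (⨂[F] _ : ι, A) ≃ₐ[F] (⨂[F] _ : ι, A) :=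
  AlgEquiv.ofLinearEquiv (PiTensorProduct.reindex F (fun _ => A) τ)
    (by
      rw [PiTensorProduct.one_def]
      exact PiTensorProduct.reindex_tprod τ _)
    ((LinearMap.map_mul_iff (PiTensorProduct.reindex F (fun _ => A) τ).toLinearMap).2 (by
      ext x y
      change PiTensorProduct.reindex F (fun _ => A) τ
          (PiTensorProduct.tprod F x * PiTensorProduct.tprod F y) =
        PiTensorProduct.reindex F (fun _ => A) τ (PiTensorProduct.tprod F x) *
          PiTensorProduct.reindex F (fun _ => A) τ (PiTensorProduct.tprod F y)
      rw [PiTensorProduct.tprod_mul_tprod, PiTensorProduct.reindex_tprod,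
        PiTensorProduct.reindex_tprod, PiTensorProduct.reindex_tprod]
      exact (PiTensorProduct.tprod_mul_tprod _ _).symm))

theorem tensorPowerPerm_tprod {F A : Type*} [Field F] [Ring A] [Algebra F A] {ι : Type*}
    (τ : Equiv.Perm ι) (x : ι → A) :
    tensorPowerPerm F A τ (PiTensorProduct.tprod F x) =
      PiTensorProduct.tprod F (tupleShift τ⁻¹ A x) :=
  PiTensorProduct.reindex_tprod (R := F) (s := fun _ => A) τ x

/-- Tensor power of a matrix representation. -/
noncomputable def tensorPowerRep {F A Ω ι : Type*} [Field F] [Ring A] [Algebra F A] [Field Ω]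
    [Algebra F Ω] [Fintype ι] [DecidableEq ι] {n : ℕ} (ψ : A →ₐ[F] Matrix (Fin n) (Fin n) Ω) :
    (⨂[F] _ : ι, A) →ₐ[F] Matrix (ι → Fin n) (ι → Fin n) Ω :=
  PiTensorProduct.liftAlgHom
    (show MultilinearMap F (fun _ : ι => A) ((ι → Fin n) → (ι → Fin n) → Ω) from
      MultilinearMap.pi fun u => MultilinearMap.pi fun v =>
        (MultilinearMap.mkPiAlgebra F ι Ω).compLinearMap fun k =>
          (Matrix.entryLinearMap F Ω (u k) (v k)) ∘ₗ ψ.toLinearMap)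
    (by
      funext u v
      change ∏ k, ψ 1 (u k) (v k) = (1 : Matrix _ _ Ω) u v
      simp only [map_one, Matrix.one_apply]
      rw [Finset.prod_ite_zero]
      simp [funext_iff])
    (by
      intro x y
      funext u v
      change ∏ k, ψ (x k * y k) (u k) (v k) =
        ∑ w : ι → Fin n, (∏ k, ψ (x k) (u k) (w k)) * ∏ k, ψ (y k) (w k) (v k)
      simp only [map_mul, Matrix.mul_apply, Finset.prod_univ_sum, Fintype.piFinset_univ,
        Finset.prod_mul_distrib])

theorem tensorPowerRep_tprod {F A Ω ι : Type*} [Field F] [Ring A] [Algebra F A] [Field Ω]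
    [Algebra F Ω] [Fintype ι] [DecidableEq ι] {n : ℕ} (ψ : A →ₐ[F] Matrix (Fin n) (Fin n) Ω)
    (x : ι → A) (u v : ι → Fin n) :
    tensorPowerRep ψ (PiTensorProduct.tprod F x) u v = ∏ k, ψ (x k) (u k) (v k) := by
  have := PiTensorProduct.lift.tprod (R := F) (φ := (show MultilinearMap F (fun _ : ι => A) ((ι → Fin n) → (ι → Fin n) → Ω) from
      MultilinearMap.pi fun u => MultilinearMap.pi fun v =>
        (MultilinearMap.mkPiAlgebra F ι Ω).compLinearMap fun k =>
          (Matrix.entryLinearMap F Ω (u k) (v k)) ∘ₗ ψ.toLinearMap)) x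
  exact congrFun (congrFun this u) v

theorem tensorPowerRep_tensorPowerPerm {F A Ω ι : Type*} [Field F] [Ring A] [Algebra F A]
    [Field Ω] [Algebra F Ω] [Fintype ι] [DecidableEq ι] {n : ℕ}
    (ψ : A →ₐ[F] Matrix (Fin n) (Fin n) Ω) (τ : Equiv.Perm ι) (x : ⨂[F] _ : ι, A)
    (u v : ι → Fin n) :
    tensorPowerRep ψ (tensorPowerPerm F A τ x) u v =
      tensorPowerRep ψ x (tupleShift τ _ u) (tupleShift τ _ v) := by
  induction x using PiTensorProduct.induction_on with
  | smul_tprod r x =>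
    rw [map_smul, map_smul, map_smul, Matrix.smul_apply, Matrix.smul_apply,
      tensorPowerPerm_tprod, tensorPowerRep_tprod, tensorPowerRep_tprod]
    congr 1
    refine (Fintype.prod_equiv τ _ _ fun k => ?_).symm
    rw [tupleShift_apply, tupleShift_apply, tupleShift_apply, Equiv.Perm.inv_def, Equiv.symm_apply_apply]
  | add x y hx hy => rw [map_add, map_add, map_add, Matrix.add_apply, Matrix.add_apply, hx, hy]

theorem tensorPowerPerm_pow_tprod {F A ι : Type*} [Field F] [Ring A] [Algebra F A]
    (τ : Equiv.Perm ι) (k : ℕ) (x : ι → A) :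
    (tensorPowerPerm F A τ ^ k) (PiTensorProduct.tprod F x) =
      PiTensorProduct.tprod F ((tupleShift τ⁻¹ A ^ k) x) := by
  induction k with
  | zero => rfl
  | succ k ih =>
    rw [pow_succ', AlgEquiv.mul_apply, ih, tensorPowerPerm_tprod, pow_succ',
      Equiv.Perm.mul_apply]

theorem tupleShift_inv {ι Y : Type*} (τ : Equiv.Perm ι) :
    tupleShift τ⁻¹ Y = (tupleShift τ Y)⁻¹ := rfl

theorem exists_tprod_add {F A : Type*} [Field F] [Ring A] [Algebra F A] {p : ℕ}
    [NeZero p] (hp : p.Prime) (a b : A) :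
    ∃ y : ⨂[F] _ : Fin p, A, PiTensorProduct.tprod F (fun _ : Fin p => a + b) =
      PiTensorProduct.tprod F (fun _ : Fin p => a) + PiTensorProduct.tprod F (fun _ : Fin p => b) +
      ∑ i ∈ Finset.range p, (tensorPowerPerm F A (Equiv.addRight (1 : Fin p)) ^ i) y := by
  set τ : Equiv.Perm (Fin p) := Equiv.addRight (1 : Fin p) with hτ
  let c : Bool → A := fun s => cond s a b
  have hsum : PiTensorProduct.tprod F (fun _ : Fin p => a + b) =
      ∑ s : Fin p → Bool, PiTensorProduct.tprod F (fun k => c (s k)) := by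
    rw [← (PiTensorProduct.tprod F).map_sum (fun (_ : Fin p) (t : Bool) => c t)]
    simp [c]
  obtain ⟨T, hT⟩ := sum_eq_sum_fixed_add_sum_orbit hp (tupleShift τ⁻¹ Bool)
    (tupleShift_pow_eq_one (by rw [inv_pow, addRight_one_pow_eq_one, inv_one]))
    (fun s => PiTensorProduct.tprod F (fun k => c (s k)))
  refine ⟨∑ s ∈ T, PiTensorProduct.tprod F (fun k => c (s k)), ?_⟩
  rw [hsum, hT]
  congr 1
  · have : (Finset.univ.filter fun s : Fin p → Bool => tupleShift τ⁻¹ Bool s = s) =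
        {fun _ => true, fun _ => false} := by
      ext s
      rw [Finset.mem_filter, tupleShift_inv, Equiv.Perm.inv_eq_iff_eq, eq_comm,
        tupleShift_addRight_eq_self_iff]
      simp [or_comm]
    rw [this, Finset.sum_pair]
    · rfl
    · intro h
      simpa using congrFun h 0
  · refine Finset.sum_congr rfl fun i _ => ?_
    rw [map_sum]
    refine Finset.sum_congr rfl fun s _ => ?_
    rw [tensorPowerPerm_pow_tprod]
    congr 1
    funext k
    rw [tupleShift_pow_apply, tupleShift_pow_apply]

theorem finrank_tensorPower (F A : Type*) [Field F] [Ring A] [Algebra F A]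
    [FiniteDimensional F A] (ι : Type*) [Fintype ι] :
    Module.finrank F (⨂[F] _ : ι, A) = Module.finrank F A ^ Fintype.card ι := by
  classical
  rw [Module.finrank_eq_card_basis
    (Basis.piTensorProduct fun _ : ι => Module.finBasis F A)]
  simp

theorem exists_ringHom_matrix_of_tensorPower {p : ℕ} (hp : p.Prime) {F A : Type} [Field F]
    [CharP F p] [Ring A] [Algebra F A] [Algebra.IsCentral F A] [IsSimpleRing A]
    [FiniteDimensional F A] (h : IsSplitAlg F (⨂[F] _ : Fin p, A)) :
    ∃ n : ℕ, 0 < n ∧ Module.finrank F A = n ^ 2 ∧ ∃ ρ : A →+* Matrix (Fin n) (Fin n) F,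
      ∀ f, ρ (algebraMap F A f) = algebraMap F _ (f ^ p) := by
  have : NeZero p := ⟨hp.ne_zero⟩
  set Ω := AlgebraicClosure F
  have := isSimpleRing_baseChange F Ω A
  obtain ⟨n, hn, ⟨ε⟩⟩ := IsSimpleRing.exists_algEquiv_matrix_of_isAlgClosed Ω (Ω ⊗[F] A)
  have hA : Module.finrank F A = n ^ 2 := by
    rw [← Module.finrank_baseChange (R := Ω) (S := F), ε.toLinearEquiv.finrank_eq,
      Module.finrank_matrix]
    simp [sq]
  refine ⟨n, Nat.pos_of_ne_zero hn.out, hA, ?_⟩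
  let ψ : A →ₐ[F] Matrix (Fin n) (Fin n) Ω :=
    (ε.toAlgHom.restrictScalars F).comp Algebra.TensorProduct.includeRight
  obtain ⟨m, hm, ⟨Φ⟩⟩ := h
  have hX : Fintype.card (Fin p → Fin n) = m := by
    have h1 := Φ.toLinearEquiv.finrank_eq
    rw [finrank_tensorPower, hA, Module.finrank_matrix] at h1
    simp only [Fintype.card_fin, Module.finrank_self, mul_one] at h1
    rw [Fintype.card_fun, Fintype.card_fin, Fintype.card_fin]
    refine (Nat.pow_left_injective (n := 2) (by norm_num)) ?_
    simp only
    rw [← pow_mul, mul_comm, pow_mul, h1, sq]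
  set τ : Equiv.Perm (Fin p) := Equiv.addRight (1 : Fin p)
  set π := tupleShift τ (Fin n)
  have hπ : π ^ p = 1 := tupleShift_pow_eq_one addRight_one_pow_eq_one
  let χ : Matrix (Fin m) (Fin m) F →ₐ[F] Module.End Ω ((Fin p → Fin n) → Ω) :=
    ((Matrix.toLinAlgEquiv' (R := Ω) (n := Fin p → Fin n)).toAlgHom.restrictScalars F).comp
      ((tensorPowerRep (ι := Fin p) ψ).comp Φ.symm.toAlgHom)
  let s := tensorPowerPerm F A τ
  let σ : Matrix (Fin m) (Fin m) F ≃ₐ[F] Matrix (Fin m) (Fin m) F := (Φ.symm.trans s).trans Φ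
  have hσ : ∀ a, χ (σ a) * permOperator Ω π = permOperator Ω π * χ a := by
    intro a
    refine LinearMap.ext fun f => funext fun u => ?_
    have hχ : ∀ (a) (f : (Fin p → Fin n) → Ω) u,
        χ a f u = ∑ v, tensorPowerRep ψ (Φ.symm a) u v * f v := fun a f u => rfl
    have hP : ∀ f u, permOperator Ω π f u = f (π u) := fun f u => rfl
    rw [Module.End.mul_apply, Module.End.mul_apply, hχ, hP, hχ]
    refine Fintype.sum_equiv π _ _ fun v => ?_
    have : Φ.symm (σ a) = s (Φ.symm a) := Φ.symm_apply_apply _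
    rw [this, tensorPowerRep_tensorPowerPerm, hP]
  obtain ⟨e, T, hep, hσe, hT⟩ := exists_matrix_conj_permOperator hp hX π hπ (fun _ => 0) rfl χ σ hσ
  have hfix : Fintype.card {x // π x = x} = n := by
    refine Eq.trans ?_ (Fintype.card_fin n)
    refine Fintype.card_congr (Equiv.ofBijective
      (fun y : Fin n => (⟨fun _ => y, rfl⟩ : {x // π x = x})) ⟨fun y z h => ?_, fun x => ?_⟩).symm
    · exact congrFun (congrArg Subtype.val h) 0
    · obtain ⟨y, hy⟩ := (tupleShift_addRight_eq_self_iff x.1).1 x.2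
      exact ⟨y, Subtype.ext hy.symm⟩
  have hker := finrank_ker_matrix_of_conj hp π hπ e T hT
  rw [hfix] at hker
  have hσi : ∀ i a, Φ ((s ^ i) (Φ.symm a)) * e ^ i = e ^ i * a := by
    intro i
    induction i with
    | zero => intro a; simp
    | succ i ih =>
      intro a
      have h1 : Φ ((s ^ (i + 1)) (Φ.symm a)) = σ (Φ ((s ^ i) (Φ.symm a))) := by
        simp [σ, pow_succ', AlgEquiv.mul_apply]
      rw [h1, pow_succ', ← mul_assoc, hσe, mul_assoc, ih, mul_assoc]
  refine exists_ringHom_tate (W := Fin m → F) (Matrix.toLinAlgEquiv' e)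
    (by rw [← map_pow, hep, map_one]) hker
    (fun a => Matrix.toLinAlgEquiv' (Φ (PiTensorProduct.tprod F fun _ => a))) ?_ ?_ ?_ ?_ ?_
  · have h0 : PiTensorProduct.tprod F (fun _ : Fin p => (0 : A)) = 0 :=
      MultilinearMap.map_coord_zero _ 0 rfl
    simp only [h0, map_zero]
  · intro f
    have hf : PiTensorProduct.tprod F (fun _ : Fin p => algebraMap F A f) =
        algebraMap F _ (f ^ p) := by
      simp only [Algebra.algebraMap_eq_smul_one]
      rw [MultilinearMap.map_smul_univ (PiTensorProduct.tprod F) (fun _ : Fin p => f)]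
      simp [PiTensorProduct.one_def]
      rfl
    simp only [hf, AlgEquiv.commutes]
  · intro a b
    rw [← map_mul, ← map_mul, PiTensorProduct.tprod_mul_tprod]
    rfl
  · intro a
    have h1 : σ (Φ (PiTensorProduct.tprod F fun _ => a)) = Φ (PiTensorProduct.tprod F fun _ => a) := by
      simp only [σ, AlgEquiv.trans_apply, AlgEquiv.symm_apply_apply, s, tensorPowerPerm_tprod]
      rfl
    have := hσe (Φ (PiTensorProduct.tprod F fun _ => a))
    rw [h1] at this
    exact Commute.map (f := Matrix.toLinAlgEquiv') this
  · intro a b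
    obtain ⟨y, hy⟩ := exists_tprod_add (F := F) hp a b
    refine ⟨Matrix.toLinAlgEquiv' (Φ y), fun i => Matrix.toLinAlgEquiv' (Φ ((s ^ i) y)), ?_, ?_⟩
    · intro i
      rw [← map_pow, ← map_mul, ← map_mul, ← hσi, Φ.symm_apply_apply]
    · simp only [hy, map_add, map_sum]
      rfl

/-- If the `p`-th tensor power of `A` is split, `A` is split by every field containing the
`p`-th roots of the elements of the base field. -/
theorem isSplitAlg_baseChange_of_tensorPower {p : ℕ} (hp : p.Prime) {F A E : Type} [Field F]
    [CharP F p] [Ring A] [Algebra F A] [Algebra.IsCentral F A] [IsSimpleRing A]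
    [FiniteDimensional F A] (h : IsSplitAlg F (⨂[F] _ : Fin p, A)) [Field E] [Algebra F E]
    (hE : ∀ f : F, ∃ g : E, g ^ p = algebraMap F E f) : IsSplitAlg E (E ⊗[F] A) := by
  obtain ⟨n, hn, hA, ρ, hρ⟩ := exists_ringHom_matrix_of_tensorPower hp h
  have : CharP E p := charP_of_injective_algebraMap (algebraMap F E).injective p
  have : Fact p.Prime := ⟨hp⟩
  choose r hr using hE
  have hinj : ∀ x y : E, x ^ p = y ^ p → x = y := fun x y hxy => frobenius_inj E p hxy
  let R : F →+* E :=
    { toFun := r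
      map_one' := hinj _ _ (by rw [hr]; simp)
      map_zero' := hinj _ _ (by rw [hr]; simp [hp.ne_zero])
      map_mul' := fun x y => hinj _ _ (by rw [hr, mul_pow, hr, hr, map_mul])
      map_add' := fun x y => hinj _ _ (by rw [hr, add_pow_char, hr, hr, map_add]) }
  have hR : ∀ f, R (f ^ p) = algebraMap F E f := fun f => by rw [map_pow]; exact hr f
  let θ : A →ₐ[F] Matrix (Fin n) (Fin n) E :=
    { toRingHom := R.mapMatrix.comp ρ
      commutes' := fun f => by
        change R.mapMatrix (ρ (algebraMap F A f)) = _
        rw [hρ]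
        ext i j
        rw [RingHom.mapMatrix_apply, Matrix.map_apply, Matrix.algebraMap_matrix_apply,
          Matrix.algebraMap_matrix_apply, apply_ite R, map_zero]
        exact if_congr Iff.rfl (hR f) rfl }
  let Θ : E ⊗[F] A →ₐ[E] Matrix (Fin n) (Fin n) E :=
    Algebra.TensorProduct.lift (Algebra.ofId E _) θ fun e a => Algebra.commutes e (θ a)
  have := isSimpleRing_baseChange F E A
  have : NeZero n := ⟨hn.ne'⟩
  have hΘ : Function.Injective Θ := Θ.toRingHom.injective
  refine ⟨n, hn, ⟨AlgEquiv.ofBijective Θ ⟨hΘ, ?_⟩⟩⟩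
  refine (LinearMap.injective_iff_surjective_of_finrank_eq_finrank (f := Θ.toLinearMap) ?_).1 hΘ
  rw [Module.finrank_baseChange, hA, Module.finrank_matrix]
  simp [sq]

theorem exists_sum_smul_pow_apply {p : ℕ} (hp : p.Prime) {E V : Type*} [Field E] [AddCommGroup V]
    [Module E V] (hV : Module.finrank E V = p) {j : Module.End E V} {b : E}
    (hj : j ^ p = algebraMap E _ b) (hb : ∀ β : E, β ^ p ≠ b) {v : V} (hv : v ≠ 0) (u : V) :
    ∃ c : ℕ → E, u = ∑ k ∈ Finset.range p, c k • (j ^ k) v := by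
  have hfin : FiniteDimensional E V := Module.finite_of_finrank_pos (by rw [hV]; exact hp.pos)
  let f : Polynomial.degreeLT E p →ₗ[E] V :=
    (LinearMap.applyₗ v ∘ₗ (Polynomial.aeval j).toLinearMap) ∘ₗ (Polynomial.degreeLT E p).subtype
  have hf : ∀ q, f q = Polynomial.aeval j q.1 v := fun q => rfl
  have hinj : Function.Injective f := by
    refine (injective_iff_map_eq_zero f).2 fun q hq => ?_
    by_contra hq0
    have hirr := X_pow_sub_C_irreducible_of_prime hp hb
    have hdeg : ¬ (Polynomial.X ^ p - Polynomial.C b) ∣ q.1 := by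
      intro hdvd
      have h1 := Polynomial.degree_le_of_dvd hdvd (fun h => hq0 (Subtype.ext h))
      rw [Polynomial.degree_X_pow_sub_C hp.pos] at h1
      exact absurd (Polynomial.mem_degreeLT.1 q.2) (not_lt.2 h1)
    obtain ⟨r, s, hrs⟩ := (hirr.coprime_iff_not_dvd.2 hdeg)
    have h2 := congrArg (fun g => Polynomial.aeval j g v) hrs
    simp only [map_add, map_mul, map_sub, map_pow, Polynomial.aeval_X, Polynomial.aeval_C, hj,
      sub_self, mul_zero, zero_add, map_one, Module.End.mul_apply, Module.End.one_apply] at h2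
    rw [hf] at hq
    rw [hq, map_zero] at h2
    exact hv h2.symm
  have hsurj : Function.Surjective f := by
    refine (LinearMap.injective_iff_surjective_of_finrank_eq_finrank ?_).1 hinj
    rw [hV, (Polynomial.degreeLTEquiv E p).finrank_eq, Module.finrank_fin_fun]
  obtain ⟨q, rfl⟩ := hsurj u
  refine ⟨q.1.coeff, ?_⟩
  have hdeg : q.1.natDegree < p := by
    by_cases h0 : q.1 = 0
    · rw [h0, Polynomial.natDegree_zero]; exact hp.pos
    · exact (Polynomial.natDegree_lt_iff_degree_lt h0).2 (Polynomial.mem_degreeLT.1 q.2)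
  rw [hf, Polynomial.aeval_eq_sum_range' hdeg]
  simp [LinearMap.sum_apply]

/-- Relations satisfied by the standard generators of a symbol algebra in characteristic `p`. -/
theorem mul_sub_sum_smul_pow {E R : Type*} [Field E] [Ring R] [Algebra E R] {i j : R}
    (hij : j * i = (i - 1) * j) (s : Finset ℕ) (c : ℕ → E) :
    j * (i - ∑ k ∈ s, c k • j ^ (k + 1)) = (i - ∑ k ∈ s, c k • j ^ (k + 1) - 1) * j := by
  have : j * ∑ k ∈ s, c k • j ^ (k + 1) = (∑ k ∈ s, c k • j ^ (k + 1)) * j := by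
    rw [Finset.mul_sum, Finset.sum_mul]
    refine Finset.sum_congr rfl fun k _ => ?_
    rw [mul_smul_comm, smul_mul_assoc, pow_mul_comm']
  rw [mul_sub, this, hij]
  noncomm_ring

theorem pow_sub_algebraMap_ne_zero {p : ℕ} (hp : p.Prime) {E R : Type*} [Field E] [Ring R]
    [Nontrivial R] [Algebra E R] [CharP R p] {i j : R} (hj : j ≠ 0)
    (hij : j * i = (i - 1) * j) (l : E) : i ^ p - algebraMap E R l ≠ 0 := by
  intro h
  have : Fact p.Prime := ⟨hp⟩
  have h1 : ∀ k : ℕ, j * i ^ k = (i - 1) ^ k * j := by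
    intro k
    induction k with
    | zero => simp
    | succ k ih => rw [pow_succ, ← mul_assoc, ih, mul_assoc, hij, ← mul_assoc, pow_succ]
  have h2 := h1 p
  rw [sub_pow_char_of_commute _ (Commute.one_right i), one_pow, sub_eq_zero.1 h, sub_mul,
    ← Algebra.commutes, one_mul] at h2
  exact hj (sub_eq_self.1 h2.symm)

theorem exists_coeffs_isSplitAlg {p : ℕ} (hp : p.Prime) {M E C : Type} [Field M] [CharP M p]
    [Field E] [Algebra M E] [Ring C] [Algebra M C] (hC : IsCyclicPAlg p M C)
    (hE : IsSplitAlg E (E ⊗[M] C)) (hEM : ∀ z : E, z ^ p ∈ (algebraMap M E).range) :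
    ∃ c : Fin (p - 1) → E, ∀ (N : Type) [Field N] [Algebra M N] [Algebra N E]
      [IsScalarTower M N E], (∀ k, c k ∈ (algebraMap N E).range) → IsSimpleRing (N ⊗[M] C) →
      IsSplitAlg N (N ⊗[M] C) := by
  obtain ⟨a, b, hb0, hCp, i, j, -, hj, hij, -⟩ := hC
  have : Fact p.Prime := ⟨hp⟩
  have : CharP E p := charP_of_injective_algebraMap (algebraMap M E).injective p
  have : FiniteDimensional M C := Module.finite_of_finrank_pos (by rw [hCp]; exact pow_pos hp.pos _)
  obtain ⟨m, hm, ⟨φ⟩⟩ := hE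
  obtain rfl : m = p := by
    have h1 := φ.toLinearEquiv.finrank_eq
    rw [Module.finrank_baseChange, hCp, Module.finrank_matrix] at h1
    simp only [Fintype.card_fin, Module.finrank_self, mul_one, ← sq] at h1
    exact (Nat.pow_left_injective (n := 2) (by norm_num) h1).symm
  let V := Fin m → E
  let Φ : E ⊗[M] C ≃ₐ[E] Module.End E V := φ.trans Matrix.toLinAlgEquiv'
  have key : ∀ (N : Type) [Field N] [Algebra M N] [Algebra N E] [IsScalarTower M N E],
      ∃ g : N ⊗[M] C →ₐ[N] Module.End E V, ∀ x, g (1 ⊗ₜ x) = Φ (1 ⊗ₜ x) := by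
    intro N _ _ _ _
    refine ⟨Algebra.TensorProduct.lift (Algebra.ofId N _) (((Φ.toAlgHom.restrictScalars M).comp
      Algebra.TensorProduct.includeRight)) fun n x =>
        Algebra.commute_algebraMap_left n _, fun x => ?_⟩
    refine (Algebra.TensorProduct.lift_tmul _ _ _ _ _).trans ?_
    rw [map_one, one_mul]
    rfl
  have hjN : ∀ (N : Type) [Field N] [Algebra M N],
      ((1 : N) ⊗ₜ[M] j) ^ m = algebraMap M (N ⊗[M] C) b := by
    intro N _ _
    rw [Algebra.TensorProduct.tmul_pow, one_pow, hj, ← Algebra.TensorProduct.algebraMap_apply']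
  have hijN : ∀ (N : Type) [Field N] [Algebra M N],
      ((1 : N) ⊗ₜ[M] j) * (1 ⊗ₜ i) = (1 ⊗ₜ i - 1) * (1 ⊗ₜ j) := by
    intro N _ _
    rw [Algebra.TensorProduct.one_def, ← TensorProduct.tmul_sub,
      Algebra.TensorProduct.tmul_mul_tmul, Algebra.TensorProduct.tmul_mul_tmul, hij]
  have hjN0 : ∀ (N : Type) [Field N] [Algebra M N] [Nontrivial (N ⊗[M] C)],
      ((1 : N) ⊗ₜ[M] j) ≠ 0 := by
    intro N _ _ _ h
    have h1 := hjN N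
    rw [h, zero_pow hp.ne_zero] at h1
    exact hb0 ((map_eq_zero _).1 h1.symm)
  by_cases hb : ∃ β : E, β ^ m = algebraMap M E b
  · obtain ⟨β, hβ⟩ := hb
    refine ⟨fun _ => β, fun N _ _ _ _ hN hsimp => ?_⟩
    obtain ⟨β', hβ'⟩ := hN ⟨0, Nat.sub_pos_of_lt hp.one_lt⟩
    have : CharP N m := charP_of_injective_algebraMap (algebraMap M N).injective m
    have : CharP (N ⊗[M] C) m := charP_of_injective_algebraMap (algebraMap N _).injective m
    have hβN : β' ^ m = algebraMap M N b := (algebraMap N E).injective (by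
      rw [map_pow, hβ', hβ, ← IsScalarTower.algebraMap_apply])
    refine isSplitAlg_of_not_isUnit hp (C := N ⊗[M] C)
      (x := (1 : N) ⊗ₜ[M] j - algebraMap N _ β') (by rw [Module.finrank_baseChange, hCp]) ?_ ?_
    · intro h0
      have h1 := hijN N
      rw [sub_eq_zero.1 h0, Algebra.commutes, sub_mul, one_mul] at h1
      have h2 : algebraMap N (N ⊗[M] C) β' = 0 := sub_eq_self.1 h1.symm
      exact hjN0 N ((sub_eq_zero.1 h0).trans h2)
    · intro hu
      have h1 := hu.pow m
      rw [sub_pow_char_of_commute _ (Algebra.commutes β' _).symm, hjN, ← map_pow, hβN,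
        ← IsScalarTower.algebraMap_apply, sub_self] at h1
      exact not_isUnit_zero h1
  · push Not at hb
    have : NeZero m := ⟨hp.ne_zero⟩
    obtain ⟨v, hv⟩ : ∃ v : V, v ≠ 0 := exists_ne 0
    obtain ⟨c, hc⟩ := exists_sum_smul_pow_apply hp (V := V) (by simp [V]) (j := Φ (1 ⊗ₜ j))
      (by rw [← map_pow, hjN, IsScalarTower.algebraMap_apply M E, AlgEquiv.commutes]) hb hv
      (Φ (1 ⊗ₜ i) v)
    refine ⟨fun k => c (k + 1), fun N _ _ _ _ hN hsimp => ?_⟩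
    have : CharP N m := charP_of_injective_algebraMap (algebraMap M N).injective m
    have : CharP (N ⊗[M] C) m := charP_of_injective_algebraMap (algebraMap N _).injective m
    choose d hd using fun k : Fin (m - 1) => hN k
    obtain ⟨l, hl⟩ := hEM (c 0)
    let d' : ℕ → N := fun k => if h : k < m - 1 then d ⟨k, h⟩ else 0
    have hd' : ∀ k ∈ Finset.range (m - 1), algebraMap N E (d' k) = c (k + 1) := by
      intro k hk
      simp only [d', dif_pos (Finset.mem_range.1 hk), hd]
    set x : N ⊗[M] C := 1 ⊗ₜ i - ∑ k ∈ Finset.range (m - 1), d' k • (1 ⊗ₜ j) ^ (k + 1)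
    refine isSplitAlg_of_not_isUnit hp (C := N ⊗[M] C)
      (x := x ^ m - algebraMap N _ (algebraMap M N l)) (by rw [Module.finrank_baseChange, hCp])
      (pow_sub_algebraMap_ne_zero hp (hjN0 N) (mul_sub_sum_smul_pow (hijN N) _ _) _) ?_
    obtain ⟨g, hg⟩ := key N
    intro hu
    have h1 := hu.map g
    have h2 : g (x ^ m - algebraMap N _ (algebraMap M N l)) =
        (g x - algebraMap E _ (c 0)) ^ m := by
      have : CharP (Module.End E V) m :=
        charP_of_injective_algebraMap (algebraMap E _).injective m
      rw [sub_pow_char_of_commute _ (Algebra.commutes (c 0) _).symm, map_sub, map_pow,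
        AlgHom.commutes, ← map_pow (algebraMap E _), ← hl, ← IsScalarTower.algebraMap_apply,
        ← IsScalarTower.algebraMap_apply M E]
    rw [h2, isUnit_pow_iff hp.ne_zero] at h1
    have hsucc : Finset.range m = Finset.range (m - 1 + 1) := by
      rw [Nat.sub_add_cancel hp.one_le]
    refine hv ((Module.End.isUnit_iff _).1 h1 |>.1 ?_)
    rw [map_zero, LinearMap.sub_apply, map_sub, LinearMap.sub_apply, hg, hc, map_sum,
      LinearMap.sum_apply, hsucc]
    rw [Finset.sum_range_succ']
    have h3 : ∀ k ∈ Finset.range (m - 1), g (d' k • (1 ⊗ₜ j) ^ (k + 1)) v =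
        c (k + 1) • ((Φ (1 ⊗ₜ j)) ^ (k + 1)) v := by
      intro k hk
      rw [map_smul, map_pow, hg, LinearMap.smul_apply, ← hd' k hk, algebraMap_smul]
    rw [Finset.sum_congr rfl h3]
    simp [Module.algebraMap_end_apply]

/-- Matrix algebras commute with base change. -/
noncomputable def tensorMatrixAlgEquiv (M X B : Type*) [Field M] [Field X] [Algebra M X] [Ring B]
    [Algebra M B] (n : ℕ) :
    X ⊗[M] Matrix (Fin n) (Fin n) B ≃ₐ[X] Matrix (Fin n) (Fin n) (X ⊗[M] B) :=
  ((Algebra.TensorProduct.congr (Matrix.uniqueAlgEquiv (m := Unit) (R := X) (A := X)).symm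
    (AlgEquiv.refl (R := M))).trans
    (Matrix.kroneckerTMulAlgEquiv Unit (Fin n) M X X B)).trans
    (Matrix.reindexAlgEquiv X _ (Equiv.uniqueProd (Fin n) Unit))

/-- Transitivity of base change for possibly noncommutative algebras. -/
noncomputable def baseChangeTransAlgEquiv (F M X A : Type*) [Field F] [Field M] [Field X]
    [Algebra F M] [Algebra F X] [Algebra M X] [IsScalarTower F M X] [Ring A] [Algebra F A] :
    X ⊗[F] A ≃ₐ[X] X ⊗[M] (M ⊗[F] A) :=
  AlgEquiv.ofLinearEquiv
    (TensorProduct.AlgebraTensorModule.cancelBaseChange F M X X A).symm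
    (by simp [Algebra.TensorProduct.one_def]) <|
      LinearMap.map_mul_of_map_mul_tmul (fun _ _ _ _ => by simp)

theorem IsBrauerEquiv.baseChange {F M A C : Type} [Field F] [Field M] [Algebra F M] [Ring A]
    [Algebra F A] [Ring C] [Algebra M C] (h : IsBrauerEquiv M (M ⊗[F] A) C) (X : Type) [Field X]
    [Algebra F X] [Algebra M X] [IsScalarTower F M X] :
    IsBrauerEquiv X (X ⊗[F] A) (X ⊗[M] C) := by
  obtain ⟨n, m, hn, hm, ⟨e⟩⟩ := h
  refine ⟨n, m, hn, hm, ⟨?_⟩⟩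
  exact (((baseChangeTransAlgEquiv F M X A).mapMatrix.trans
    (tensorMatrixAlgEquiv M X (M ⊗[F] A) n).symm).trans
    (Algebra.TensorProduct.congr AlgEquiv.refl e)).trans (tensorMatrixAlgEquiv M X C m)

theorem IsBrauerEquiv.isSimpleRing {F A C : Type} [Field F] [Ring A] [Algebra F A]
    [IsSimpleRing A] [Ring C] [Algebra F C] (h : IsBrauerEquiv F A C) : IsSimpleRing C := by
  obtain ⟨n, m, hn, hm, ⟨e⟩⟩ := h
  have : NeZero n := ⟨hn.ne'⟩
  exact isSimpleRing_of_matrix hm (IsSimpleRing.of_ringEquiv e.toRingEquiv inferInstance)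

theorem IsBrauerEquiv.isSplitAlg {F A C : Type} [Field F] [Ring A] [Algebra F A]
    [IsSimpleRing A] [FiniteDimensional F A] [Ring C] [Algebra F C] (h : IsBrauerEquiv F A C)
    (hC : IsSplitAlg F C) : IsSplitAlg F A := by
  obtain ⟨n, m, hn, hm, ⟨e⟩⟩ := h
  obtain ⟨k, hk, ⟨f⟩⟩ := hC
  exact isSplitAlg_of_matrix hn (Nat.mul_pos hm hk)
    ((e.trans f.mapMatrix).trans (matrixMatrixAlgEquiv F F m k))

theorem IsBrauerEquiv.symm {F A C : Type} [Field F] [Ring A] [Algebra F A]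
    [Ring C] [Algebra F C] (h : IsBrauerEquiv F A C) : IsBrauerEquiv F C A := by
  obtain ⟨n, m, hn, hm, ⟨e⟩⟩ := h
  exact ⟨m, n, hm, hn, ⟨e.symm⟩⟩

/-- The field of `p`-th roots of the elements of `L`, for a compositum `M = LK` with
`K ^ p ⊆ F`. -/
theorem exists_field_of_roots {p : ℕ} (hp : p.Prime) {F L K M : Type} [Field F] [CharP F p]
    [Field L] [Field K] [Field M] [Algebra F L] [Algebra F K] [Algebra F M] [Algebra L M]
    [Algebra K M] [IsScalarTower F L M] [IsScalarTower F K M] (hM : IsCompositum F L K M)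
    (hKp : ∀ z : K, z ^ p ∈ (algebraMap F K).range) :
    ∃ (E : Type) (_ : Field E) (_ : Algebra M E),
      (∀ z : E, z ^ p ∈ ((algebraMap M E).comp (algebraMap L M)).range) ∧
      ∀ l : L, ∃ z : E, z ^ p = algebraMap M E (algebraMap L M l) := by
  have : Fact p.Prime := ⟨hp⟩
  have : CharP M p := charP_of_injective_algebraMap (algebraMap F M).injective p
  have hML : ∀ z : M, z ^ p ∈ (algebraMap L M).range := by
    let R : Subalgebra F M :=
      { ((algebraMap L M).range.comap (frobenius M p)) with
        algebraMap_mem' := fun f => ⟨algebraMap F L f ^ p, by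
          rw [map_pow, ← IsScalarTower.algebraMap_apply]; rfl⟩ }
    have hR : R = ⊤ := by
      refine top_le_iff.1 (hM ▸ sup_le ?_ ?_)
      · rintro _ ⟨l, rfl⟩
        exact ⟨l ^ p, by rw [map_pow]; rfl⟩
      · rintro _ ⟨k, rfl⟩
        obtain ⟨f, hf⟩ := hKp k
        refine ⟨algebraMap F L f, ?_⟩
        rw [← IsScalarTower.algebraMap_apply, IsScalarTower.algebraMap_apply F K M, hf, map_pow]
        rfl
    intro z
    have : z ∈ R := hR ▸ Algebra.mem_top
    exact this
  choose r hr using hML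
  have hinj := (algebraMap L M).injective
  let φ : M →+* L :=
    { toFun := r
      map_one' := hinj (by rw [hr]; simp)
      map_zero' := hinj (by rw [hr]; simp [hp.ne_zero])
      map_mul' := fun x y => hinj (by rw [hr, map_mul, hr, hr, mul_pow])
      map_add' := fun x y => hinj (by rw [hr, map_add, hr, hr, add_pow_char]) }
  have hφ : ∀ l, φ (algebraMap L M l) = l ^ p := fun l => hinj ((hr _).trans (map_pow _ _ _).symm)
  exact ⟨L, inferInstance, φ.toAlgebra, fun z => ⟨z, hφ z⟩, fun l => ⟨l, (hφ l).symm⟩⟩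

theorem exists_sum_mul_eq_of_pow_mem {p : ℕ} (hp : p.Prime) {F L E : Type*} [Field F] [CharP F p]
    [Field L] [Algebra F L] [Algebra.IsSeparable F L] [FiniteDimensional F L] [Field E]
    [Algebra F E] [Algebra L E] [IsScalarTower F L E]
    (hE : ∀ l : L, ∃ z : E, z ^ p = algebraMap L E l) {c : E}
    (hc : c ^ p ∈ (algebraMap L E).range) :
    ∃ (g : Fin (Module.finrank F L) → E) (e : Fin (Module.finrank F L) → L),
      (∀ s, g s ^ p ∈ (algebraMap F E).range) ∧ c = ∑ s, g s * algebraMap L E (e s) := by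
  have : Fact p.Prime := ⟨hp⟩
  have : CharP E p := charP_of_injective_algebraMap (algebraMap F E).injective p
  obtain ⟨l, hl⟩ := hc
  let e := Module.finBasis F L
  have hspan := Field.span_map_pow_expChar_pow_eq_top_of_isSeparable p 1 e.span_eq
  obtain ⟨f, hf⟩ := (Submodule.mem_span_range_iff_exists_fun F).1 (hspan ▸ Submodule.mem_top (x := l))
  choose g hg using fun s => hE (algebraMap F L (f s))
  refine ⟨g, e, fun s => ⟨f s, by rw [hg, ← IsScalarTower.algebraMap_apply]⟩, ?_⟩
  refine frobenius_inj E p ?_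
  change c ^ p = (∑ s, g s * algebraMap L E (e s)) ^ p
  rw [sum_pow_char, ← hl, ← hf, map_sum]
  refine Finset.sum_congr rfl fun s _ => ?_
  rw [mul_pow, hg, pow_one, Algebra.smul_def, map_mul, map_pow]

theorem finrank_adjoin_le_pow {p : ℕ} (hp : p.Prime) {K E : Type*} [Field K] [Field E] [Algebra K E]
    (S : Finset E) (hS : ∀ s ∈ S, s ^ p ∈ (algebraMap K E).range) :
    FiniteDimensional K (IntermediateField.adjoin K (S : Set E)) ∧
      Module.finrank K (IntermediateField.adjoin K (S : Set E)) ≤ p ^ S.card := by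
  classical
  induction S using Finset.induction_on with
  | empty =>
    rw [Finset.coe_empty, IntermediateField.adjoin_empty]
    exact ⟨inferInstance, by simp⟩
  | insert s S hs ih =>
    obtain ⟨h1, h2⟩ := ih fun t ht => hS t (Finset.mem_insert_of_mem ht)
    obtain ⟨k, hk⟩ := hS s (Finset.mem_insert_self s S)
    have hne : (Polynomial.X ^ p - Polynomial.C k : Polynomial K) ≠ 0 :=
      Polynomial.X_pow_sub_C_ne_zero hp.pos k
    have hroot : Polynomial.aeval s (Polynomial.X ^ p - Polynomial.C k : Polynomial K) = 0 := by
      simp [hk]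
    have hintegral : IsIntegral K s := (IsAlgebraic.isIntegral ⟨_, hne, hroot⟩)
    have h3 : FiniteDimensional K (IntermediateField.adjoin K {s}) :=
      IntermediateField.adjoin.finiteDimensional hintegral
    have h4 : Module.finrank K (IntermediateField.adjoin K {s}) ≤ p := by
      rw [IntermediateField.adjoin.finrank hintegral]
      refine (Polynomial.natDegree_le_of_dvd (minpoly.dvd K s hroot) hne).trans_eq ?_
      exact Polynomial.natDegree_X_pow_sub_C
    rw [Finset.coe_insert, Set.insert_eq, IntermediateField.adjoin_union]
    refine ⟨IntermediateField.finiteDimensional_sup _ _, ?_⟩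
    rw [Finset.card_insert_of_notMem hs, pow_succ']
    exact (IntermediateField.finrank_sup_le _ _).trans (Nat.mul_le_mul h4 h2)

theorem exists_intermediateField_tower {p : ℕ} (hp : p.Prime) {F L K M E : Type} [Field F]
    [CharP F p] [Field L] [Field K] [Field M] [Field E] [Algebra F L] [Algebra F K] [Algebra F M]
    [Algebra L M] [Algebra K M] [IsScalarTower F L M] [IsScalarTower F K M] [Algebra F E]
    [Algebra L E] [Algebra K E] [Algebra M E] [IsScalarTower F M E] [IsScalarTower F L E]
    [IsScalarTower F K E] [IsScalarTower L M E] [IsScalarTower K M E]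
    [Algebra.IsSeparable F L] [FiniteDimensional F L] (hM : IsCompositum F L K M)
    (hKp : ∀ z : K, z ^ p ∈ (algebraMap F K).range) (S : Finset E)
    (hS : ∀ s ∈ S, s ^ p ∈ (algebraMap F E).range) :
    ∃ (K' : IntermediateField K E) (N : IntermediateField K' E),
      FiniteDimensional K K' ∧ Module.finrank K K' ≤ p ^ S.card ∧
      (∀ z : K', z ^ p ∈ (algebraMap F K').range) ∧ FiniteDimensional K' N ∧
      Module.finrank K' N ≤ Module.finrank F L ∧ (∀ m : M, algebraMap M E m ∈ N) ∧
      ∀ s ∈ S, s ∈ N := by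
  have : Fact p.Prime := ⟨hp⟩
  have : CharP E p := charP_of_injective_algebraMap (algebraMap F E).injective p
  obtain ⟨h1, h2⟩ := finrank_adjoin_le_pow (K := K) hp S fun s hs => by
    obtain ⟨f, hf⟩ := hS s hs
    exact ⟨algebraMap F K f, by rw [← IsScalarTower.algebraMap_apply, hf]⟩
  set K' := IntermediateField.adjoin K (S : Set E)
  have : IsScalarTower F K' E := IsScalarTower.of_algebraMap_eq fun _ => rfl
  obtain ⟨α, hα⟩ := Field.exists_primitive_element F L
  have hintegral : IsIntegral F α := IsIntegral.of_finite F α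
  have hintegral' : IsIntegral K' (algebraMap L E α) :=
    (hintegral.map (IsScalarTower.toAlgHom F L E)).tower_top
  set N : IntermediateField K' E := IntermediateField.adjoin K' {algebraMap L E α}
  have hKN : ∀ z : K', (z : E) ∈ N := fun z => N.algebraMap_mem z
  refine ⟨K', N, h1, h2, ?_, IntermediateField.adjoin.finiteDimensional hintegral', ?_, ?_, ?_⟩
  · rintro ⟨z, hz⟩
    have hzp : z ^ p ∈ (algebraMap F E).fieldRange := by
      have hle : K'.toSubfield ≤ (algebraMap F E).fieldRange.comap (frobenius E p) := by
        rw [IntermediateField.adjoin_toSubfield, Subfield.closure_le, Set.union_subset_iff]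
        refine ⟨?_, fun s hs => hS s hs⟩
        rintro _ ⟨k, rfl⟩
        obtain ⟨f, hf⟩ := hKp k
        refine ⟨f, ?_⟩
        rw [IsScalarTower.algebraMap_apply F K E, hf, map_pow]
        rfl
      exact hle hz
    obtain ⟨f, hf⟩ := hzp
    exact ⟨f, Subtype.ext hf⟩
  · rw [IntermediateField.adjoin.finrank hintegral', ← (Field.primitive_element_iff_minpoly_natDegree_eq F α).1 hα]
    refine (Polynomial.natDegree_le_of_dvd (q := (minpoly F α).map (algebraMap F K'))
      (minpoly.dvd _ _ ?_) ?_).trans_eq (Polynomial.natDegree_map _)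
    · rw [Polynomial.aeval_map_algebraMap, Polynomial.aeval_algebraMap_apply, minpoly.aeval, map_zero]
    · exact Polynomial.map_ne_zero (minpoly.ne_zero hintegral)
  · have hLN : ∀ l : L, algebraMap L E l ∈ N := by
      intro l
      have hle : (⊤ : IntermediateField F L) ≤
          (N.restrictScalars F).comap (IsScalarTower.toAlgHom F L E) := by
        rw [← hα, IntermediateField.adjoin_simple_le_iff]
        exact IntermediateField.mem_adjoin_simple_self K' _
      exact hle (IntermediateField.mem_top (x := l))
    intro m
    have hle : (⊤ : Subalgebra F M) ≤
        (N.restrictScalars F).toSubalgebra.comap (IsScalarTower.toAlgHom F M E) := by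
      rw [← hM]
      refine sup_le ?_ ?_
      · rintro _ ⟨l, rfl⟩
        change algebraMap M E (algebraMap L M l) ∈ N
        rw [← IsScalarTower.algebraMap_apply]
        exact hLN l
      · rintro _ ⟨k, rfl⟩
        change algebraMap M E (algebraMap K M k) ∈ N
        rw [← IsScalarTower.algebraMap_apply]
        exact hKN (algebraMap K K' k)
    exact hle (Algebra.mem_top (x := m))
  · intro s hs
    exact hKN ⟨s, IntermediateField.subset_adjoin K _ hs⟩

/-- Over a `p`-cyclic reducible field `F` of characteristic `p`, if `A` is
central simple of exponent `p` and `K/F` is finite purely inseparable with `K ^ p ⊆ F`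
and `ind A_K = p ^ n`, then there is a purely inseparable extension `K'/K` with
`K' ^ p ⊆ F`, `[K':K] ≤ p ^ ((p - 1) * p ^ (n - 1))` and `ind A_{K'} ≤ p ^ (n - 1)`. -/
theorem statement6 (p : ℕ) (hp : p.Prime) (F : Type) [Field F] [CharP F p]
    (hred : IsPCyclicReducible p F)
    (A : Type) [Ring A] [Algebra F A] (hA : IsCSA F A) (hexp : HasExponent F A p)
    (K : Type) [Field K] [Algebra F K] [FiniteDimensional F K] [IsPurelyInseparable F K]
    (hKp : ∀ z : K, z ^ p ∈ (algebraMap F K).range)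
    (n : ℕ) (hn : 0 < n) (hind : HasIndex K (K ⊗[F] A) (p ^ n)) :
    ∃ (K' : Type) (_ : Field K') (_ : Algebra F K') (_ : Algebra K K')
      (_ : IsScalarTower F K K'),
      IsPurelyInseparable K K' ∧ FiniteDimensional K K' ∧
      (∀ z : K', z ^ p ∈ (algebraMap F K').range) ∧
      Module.finrank K K' ≤ p ^ ((p - 1) * p ^ (n - 1)) ∧
      IndexLE K' (K' ⊗[F] A) (p ^ (n - 1)) := by
  have : Fact p.Prime := ⟨hp⟩
  obtain ⟨hcent, hsimp, hfin⟩ := id hA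
  have := isSimpleRing_baseChange F K A
  rcases hred A hA hexp K ‹_› hKp with hsplit |
    ⟨d, hd, L, _, _, _, hL, M, _, _, _, _, _, _, hM, C, _, _, hC, hBr⟩
  · have h1 := HasIndex.unique hind.pos hsplit.hasIndex_one.pos hind hsplit.hasIndex_one
    exact absurd h1 (Nat.one_lt_pow hn.ne' hp.one_lt).ne'
  have hdn : d = p ^ (n - 1) := by
    have h1 := HasIndex.unique hind.pos hd.pos hind hd
    obtain ⟨k, rfl⟩ := Nat.exists_eq_add_of_lt hn
    rw [Nat.zero_add, pow_succ'] at h1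
    simpa using (Nat.eq_of_mul_eq_mul_left hp.pos h1).symm
  rw [hdn] at hL
  have : FiniteDimensional F L := Module.finite_of_finrank_pos (by rw [hL]; exact pow_pos hp.pos _)
  obtain ⟨E, _, _, hE1, hE2⟩ := exists_field_of_roots hp hM hKp
  let : Algebra F E := ((algebraMap M E).comp (algebraMap F M)).toAlgebra
  let : Algebra L E := ((algebraMap M E).comp (algebraMap L M)).toAlgebra
  let : Algebra K E := ((algebraMap M E).comp (algebraMap K M)).toAlgebra
  have : IsScalarTower F M E := IsScalarTower.of_algebraMap_eq fun _ => rfl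
  have : IsScalarTower L M E := IsScalarTower.of_algebraMap_eq fun _ => rfl
  have : IsScalarTower K M E := IsScalarTower.of_algebraMap_eq fun _ => rfl
  have : IsScalarTower F L E := IsScalarTower.to₁₂₄ F L M E
  have : IsScalarTower F K E := IsScalarTower.to₁₂₄ F K M E
  have : CharP M p := charP_of_injective_algebraMap (algebraMap F M).injective p
  have hsplitE : IsSplitAlg E (E ⊗[F] A) := by
    refine isSplitAlg_baseChange_of_tensorPower hp hexp.2.1 fun f => ?_
    obtain ⟨z, hz⟩ := hE2 (algebraMap F L f)
    exact ⟨z, by rw [hz, IsScalarTower.algebraMap_apply F L E]; rfl⟩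
  have hCfin : FiniteDimensional M C := by
    obtain ⟨_, _, _, h, _⟩ := hC
    exact Module.finite_of_finrank_pos (by rw [h]; exact pow_pos hp.pos _)
  have hsimpC : ∀ (X : Type) [Field X] [Algebra F X] [Algebra M X] [IsScalarTower F M X],
      IsSimpleRing (X ⊗[M] C) := fun X _ _ _ _ =>
    have := isSimpleRing_baseChange F X A
    (hBr.baseChange X).isSimpleRing
  have := hsimpC E
  obtain ⟨c, hc⟩ := exists_coeffs_isSplitAlg hp hC ((hBr.baseChange E).symm.isSplitAlg hsplitE)
    (fun z => let ⟨l, hl⟩ := hE1 z; ⟨algebraMap L M l, hl⟩)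
  choose g e hg hge using fun k =>
    exists_sum_mul_eq_of_pow_mem (F := F) (L := L) hp hE2 (hE1 (c k))
  classical
  let S : Finset E := Finset.univ.image fun x : Fin (p - 1) × Fin (Module.finrank F L) => g x.1 x.2
  have hScard : S.card ≤ (p - 1) * p ^ (n - 1) := by
    refine Finset.card_image_le.trans_eq ?_
    simp [hL]
  obtain ⟨K', N, h1, h2, h3, h4, h5, h6, h7⟩ := exists_intermediateField_tower hp hM hKp S
    (by
      intro s hs
      obtain ⟨x, -, rfl⟩ := Finset.mem_image.1 hs
      exact hg _ _)
  have hcN : ∀ k, c k ∈ N := by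
    intro k
    rw [hge k]
    refine sum_mem fun s _ => mul_mem (h7 _ (Finset.mem_image.2 ⟨(k, s), Finset.mem_univ _, rfl⟩)) ?_
    exact h6 (algebraMap L M (e k s))
  have : IsScalarTower F K' E := IsScalarTower.of_algebraMap_eq fun _ => rfl
  let : Algebra M N := ((algebraMap M E).codRestrict N h6).toAlgebra
  have : IsScalarTower M N E := IsScalarTower.of_algebraMap_eq fun _ => rfl
  have : IsScalarTower F M N := IsScalarTower.of_algebraMap_eq fun _ => Subtype.ext rfl
  have hCN : IsSplitAlg N (N ⊗[M] C) := hc N (fun k => ⟨⟨c k, hcN k⟩, rfl⟩) (hsimpC N)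
  have := isSimpleRing_baseChange F N A
  have := isSimpleRing_baseChange F K' A
  have hAN : IsSplitAlg N (N ⊗[F] A) := (hBr.baseChange N).isSplitAlg hCN
  have : CharP K p := charP_of_injective_algebraMap (algebraMap F K).injective p
  refine ⟨K', inferInstance, inferInstance, inferInstance, inferInstance, ?_, h1, h3,
    h2.trans (Nat.pow_le_pow_right hp.pos hScard), ?_⟩
  · refine (isPurelyInseparable_iff_pow_mem K p).2 fun z => ⟨1, ?_⟩
    obtain ⟨f, hf⟩ := h3 z
    exact ⟨algebraMap F K f, by rw [← IsScalarTower.algebraMap_apply, hf, pow_one]⟩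
  · refine indexLE_of_isSplitAlg (N := N) (hAN.congr ?_) (h5.trans_eq hL)
    exact baseChangeTransAlgEquiv F K' N A
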